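/- Let m, n be positive integers, N = m+n, 0 ≤ t ≤ min(m,n), and (y,v,z,u) ∈ Σ^{m,n}_t. Let w ∈ S_N be the permutation whose matrix is the N×N block matrix with row blocks of sizes (n,m) and column blocks of sizes (n,m): top-left block w∘ⁿ·u·J^n_t·v⁻¹, top-right block w∘ⁿ·u·I^{n,m}_t·z⁻¹·w∘ᵐ, bottom-left block y·I^{m,n}_t·v⁻¹, bottom-right block y·J^m_t·z⁻¹·w∘ᵐ. Then w ≥ (w∘ⁿ,w∘ᵐ) in the Bruhat order, and P_w = ⋃_τ (B_m⁺ y B_m⁺ ∩ B_m⁻·(zτ)) · I^{m,n}_t · (τ⁻¹·(B_n⁻ u⁻¹ B_n⁻) ∩ v⁻¹·B_n⁺), where the union runs over all permutations τ fixing every index greater than t (viewed as elements of both S_m and S_n) such that zτ ≤ y in S_m and vτ⁻¹ ≤ u in S_n. -/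

import Mathlib

open Matrix

noncomputable section

abbrev Mat (k l : ℕ) := Matrix (Fin k) (Fin l) ℂ

/-- permutation matrix: (i,j) entry is 1 exactly when i = w j -/
def permMat (k : ℕ) (w : Equiv.Perm (Fin k)) : Mat k k :=
  fun i j => if i = w j then 1 else 0

/-- invertible upper triangular matrices -/
def Bp (k : ℕ) : Set (Mat k k) := {M | IsUnit M ∧ ∀ i j : Fin k, j < i → M i j = 0}

/-- invertible lower triangular matrices -/
def Bm (k : ℕ) : Set (Mat k k) := {M | IsUnit M ∧ ∀ i j : Fin k, i < j → M i j = 0}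

def dcPlus {k l : ℕ} (w : Mat k l) : Set (Mat k l) :=
  {x | ∃ b ∈ Bp k, ∃ b' ∈ Bp l, x = b * w * b'}

def dcMinus {k l : ℕ} (w : Mat k l) : Set (Mat k l) :=
  {x | ∃ b ∈ Bm k, ∃ b' ∈ Bm l, x = b * w * b'}

/-- comparison of finsets: sorted lists compare termwise -/
def finsetLE {k : ℕ} (A B : Finset (Fin k)) : Prop :=
  List.Forall₂ (· ≤ ·) (A.sort (· ≤ ·)) (B.sort (· ≤ ·))

/-- Bruhat order on S_k -/
def bruhatLE {k : ℕ} (y z : Equiv.Perm (Fin k)) : Prop :=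
  ∀ p : Fin k, finsetLE ((Finset.Iic p).image y) ((Finset.Iic p).image z)

/-- Zariski closure in the space of k×l matrices -/
def zClosure {k l : ℕ} (S : Set (Mat k l)) : Set (Mat k l) :=
  {x | ∀ p : MvPolynomial (Fin k × Fin l) ℂ,
      (∀ y ∈ S, MvPolynomial.eval (fun q => y q.1 q.2) p = 0) →
      MvPolynomial.eval (fun q => x q.1 q.2) p = 0}

def revP (k : ℕ) : Equiv.Perm (Fin k) := ⟨Fin.rev, Fin.rev, Fin.rev_rev, Fin.rev_rev⟩

def fe (m n : ℕ) : Fin n ⊕ Fin m ≃ Fin (m + n) :=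
  finSumFinEquiv.trans (finCongr (Nat.add_comm n m))

/-- the block matrix [[w∘ⁿ, 0],[x, w∘ᵐ]] -/
def embMat (m n : ℕ) (x : Mat m n) : Mat (m+n) (m+n) :=
  Matrix.reindex (fe m n) (fe m n)
    (Matrix.fromBlocks (permMat n (revP n)) 0 x (permMat m (revP m)))

/-- the permutation (w∘ⁿ,w∘ᵐ) ∈ S_{m+n} -/
def wnmPerm (m n : ℕ) : Equiv.Perm (Fin (m+n)) :=
  ((fe m n).symm.trans (Equiv.sumCongr (revP n) (revP m))).trans (fe m n)

def Pset (m n : ℕ) (w : Equiv.Perm (Fin (m+n))) : Set (Mat m n) :=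
  {x | embMat m n x ∈ dcPlus (permMat (m+n) w)}

/-- the matrix with t×t identity in upper-left corner, zeros elsewhere -/
def Imn (m n t : ℕ) : Mat m n := fun i j => if (i:ℕ) = (j:ℕ) ∧ (i:ℕ) < t then 1 else 0

/-- diagonal matrix with first t diagonal entries 0 and the rest 1 -/
def Jk (k t : ℕ) : Mat k k := fun i j => if (i:ℕ) = (j:ℕ) ∧ t ≤ (i:ℕ) then 1 else 0

noncomputable def subRank {k l : ℕ} (x : Mat k l) (R : Finset (Fin k)) (C : Finset (Fin l)) : ℕ :=
  (x.submatrix (fun i : {a // a ∈ R} => i.1) (fun j : {a // a ∈ C} => j.1)).rank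

/-- v(1) < ⋯ < v(t) -/
def headMono {k : ℕ} (t : ℕ) (v : Equiv.Perm (Fin k)) : Prop :=
  ∀ i j : Fin k, i < j → (j:ℕ) < t → v i < v j

/-- u(t+1) < ⋯ < u(k) -/
def tailMono {k : ℕ} (t : ℕ) (u : Equiv.Perm (Fin k)) : Prop :=
  ∀ i j : Fin k, i < j → t ≤ (i:ℕ) → u i < u j

def embPerm {k t : ℕ} (h : t ≤ k) (τ : Equiv.Perm (Fin t)) : Equiv.Perm (Fin k) :=
  τ.viaFintypeEmbedding (Fin.castLEEmb h)
/-- the block matrix for w: row blocks (n,m), column blocks (n,m) -/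
def wBlock (m n t : ℕ)
    (y : Equiv.Perm (Fin m)) (v : Equiv.Perm (Fin n))
    (z : Equiv.Perm (Fin m)) (u : Equiv.Perm (Fin n)) : Mat (m+n) (m+n) :=
  Matrix.reindex (fe m n) (fe m n)
    (Matrix.fromBlocks
      (permMat n (revP n) * permMat n u * Jk n t * permMat n v⁻¹)
      (permMat n (revP n) * permMat n u * Imn n m t * permMat m z⁻¹ * permMat m (revP m))
      (permMat m y * Imn m n t * permMat n v⁻¹)
      (permMat m y * Jk m t * permMat m z⁻¹ * permMat m (revP m)))

/-- the set P^t_{(y,v,z,u)} -/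
def Pt (m n t : ℕ) (htm : t ≤ m) (htn : t ≤ n)
    (y : Equiv.Perm (Fin m)) (v : Equiv.Perm (Fin n))
    (z : Equiv.Perm (Fin m)) (u : Equiv.Perm (Fin n)) : Set (Mat m n) :=
  {x | ∃ τ : Equiv.Perm (Fin t),
    bruhatLE (z * embPerm htm τ) y ∧ bruhatLE (v * (embPerm htn τ)⁻¹) u ∧
    ∃ g ∈ dcPlus (permMat m y) ∩ {g | ∃ b ∈ Bm m, g = b * permMat m (z * embPerm htm τ)},
    ∃ h ∈ {h | ∃ c ∈ dcMinus (permMat n u⁻¹), h = permMat n (embPerm htn τ)⁻¹ * c} ∩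
          {h | ∃ b ∈ Bp n, h = permMat n v⁻¹ * b},
    x = g * Imn m n t * h}


lemma permMat_mul_apply {k l : ℕ} (w : Equiv.Perm (Fin k)) (M : Mat k l) (i : Fin k) (j : Fin l) :
    (permMat k w * M) i j = M (w⁻¹ i) j := by
  rw [Matrix.mul_apply, Finset.sum_eq_single (w⁻¹ i)]
  · simp [permMat]
  · intro b _ hb
    have : i ≠ w b := by rintro rfl; simp at hb
    simp [permMat, this]
  · simp

lemma mul_permMat_apply {k l : ℕ} (w : Equiv.Perm (Fin k)) (M : Mat l k) (i : Fin l) (j : Fin k) :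
    (M * permMat k w) i j = M i (w j) := by
  rw [Matrix.mul_apply, Finset.sum_eq_single (w j)]
  · simp [permMat]
  · intro b _ hb
    simp [permMat, hb]
  · simp

lemma permMat_mul (k : ℕ) (a b : Equiv.Perm (Fin k)) :
    permMat k (a * b) = permMat k a * permMat k b := by
  ext i j
  rw [mul_permMat_apply]; rfl

lemma permMat_one (k : ℕ) : permMat k 1 = 1 := by
  ext i j
  rw [Matrix.one_apply]; rfl

lemma permMat_mul_inv (k : ℕ) (a : Equiv.Perm (Fin k)) : permMat k a * permMat k a⁻¹ = 1 := by
  rw [← permMat_mul, mul_inv_cancel, permMat_one]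

lemma permMat_inv_mul (k : ℕ) (a : Equiv.Perm (Fin k)) : permMat k a⁻¹ * permMat k a = 1 := by
  rw [← permMat_mul, inv_mul_cancel, permMat_one]

lemma permMat_inv_mul' (k l : ℕ) (a : Equiv.Perm (Fin k)) (M : Mat k l) :
    permMat k a⁻¹ * (permMat k a * M) = M := by
  rw [← Matrix.mul_assoc, permMat_inv_mul, Matrix.one_mul]

lemma permMat_mul_inv' (k l : ℕ) (a : Equiv.Perm (Fin k)) (M : Mat k l) :
    permMat k a * (permMat k a⁻¹ * M) = M := by
  rw [← Matrix.mul_assoc, permMat_mul_inv, Matrix.one_mul]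

lemma permMat_isUnit (k : ℕ) (a : Equiv.Perm (Fin k)) : IsUnit (permMat k a) :=
  IsUnit.of_mul_eq_one _ (permMat_mul_inv k a)

lemma permMat_transpose (k : ℕ) (a : Equiv.Perm (Fin k)) : (permMat k a)ᵀ = permMat k a⁻¹ := by
  ext i j
  simp only [permMat, Matrix.transpose_apply]
  have : j = a i ↔ i = a⁻¹ j := by
    constructor
    · rintro rfl; simp
    · rintro rfl; simp
  simp [this]

lemma permMat_inj {k : ℕ} {a b : Equiv.Perm (Fin k)} (h : permMat k a = permMat k b) : a = b := by
  ext j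
  have := congrFun (congrFun h (a j)) j
  simp [permMat] at this
  rw [this]

lemma revP_inv (k : ℕ) : (revP k)⁻¹ = revP k := rfl
lemma rev_mul_rev (k : ℕ) : permMat k (revP k) * permMat k (revP k) = 1 := by
  have := permMat_mul_inv k (revP k)
  rwa [revP_inv] at this
lemma rev_mul_rev' (k l : ℕ) (M : Mat k l) : permMat k (revP k) * (permMat k (revP k) * M) = M := by
  rw [← Matrix.mul_assoc, rev_mul_rev, Matrix.one_mul]

/-! triangular groups -/
lemma Bp_mul {k : ℕ} {a b : Mat k k} (ha : a ∈ Bp k) (hb : b ∈ Bp k) : a * b ∈ Bp k := by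
  refine ⟨ha.1.mul hb.1, ?_⟩
  have h1 : BlockTriangular a id := fun i j h => ha.2 i j h
  have h2 : BlockTriangular b id := fun i j h => hb.2 i j h
  exact fun i j h => (h1.mul h2) h

lemma Bm_mul {k : ℕ} {a b : Mat k k} (ha : a ∈ Bm k) (hb : b ∈ Bm k) : a * b ∈ Bm k := by
  refine ⟨ha.1.mul hb.1, ?_⟩
  have h1 : BlockTriangular a OrderDual.toDual := fun i j h => ha.2 i j h
  have h2 : BlockTriangular b OrderDual.toDual := fun i j h => hb.2 i j h
  exact fun i j h => (h1.mul h2) h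

lemma unit_inv {k : ℕ} {a : Mat k k} (ha : IsUnit a) : a * a⁻¹ = 1 ∧ a⁻¹ * a = 1 :=
  ⟨Matrix.mul_nonsing_inv _ ((Matrix.isUnit_iff_isUnit_det _).1 ha),
   Matrix.nonsing_inv_mul _ ((Matrix.isUnit_iff_isUnit_det _).1 ha)⟩

lemma Bp_inv {k : ℕ} {a : Mat k k} (ha : a ∈ Bp k) : a⁻¹ ∈ Bp k := by
  have hi := unit_inv ha.1
  refine ⟨IsUnit.of_mul_eq_one _ hi.2, ?_⟩
  have h1 : BlockTriangular a id := fun i j h => ha.2 i j h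
  have := ha.1.invertible
  exact fun i j h => (blockTriangular_inv_of_blockTriangular h1) h

lemma Bm_inv {k : ℕ} {a : Mat k k} (ha : a ∈ Bm k) : a⁻¹ ∈ Bm k := by
  have hi := unit_inv ha.1
  refine ⟨IsUnit.of_mul_eq_one _ hi.2, ?_⟩
  have h1 : BlockTriangular a OrderDual.toDual := fun i j h => ha.2 i j h
  have := ha.1.invertible
  exact fun i j h => (blockTriangular_inv_of_blockTriangular h1) h

lemma Bm_transpose {k : ℕ} {a : Mat k k} (ha : a ∈ Bm k) : aᵀ ∈ Bp k :=
  ⟨(Matrix.isUnit_transpose _).2 ha.1, fun i j h => ha.2 j i h⟩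
lemma Bp_transpose {k : ℕ} {a : Mat k k} (ha : a ∈ Bp k) : aᵀ ∈ Bm k :=
  ⟨(Matrix.isUnit_transpose _).2 ha.1, fun i j h => ha.2 j i h⟩

lemma rev_conj_apply {k : ℕ} (a : Mat k k) (i j : Fin k) :
    (permMat k (revP k) * a * permMat k (revP k)) i j = a i.rev j.rev := by
  rw [mul_permMat_apply, permMat_mul_apply]; rfl

lemma Bm_rev {k : ℕ} {a : Mat k k} (ha : a ∈ Bm k) :
    permMat k (revP k) * a * permMat k (revP k) ∈ Bp k := by
  refine ⟨((permMat_isUnit _ _).mul ha.1).mul (permMat_isUnit _ _), fun i j h => ?_⟩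
  rw [rev_conj_apply]
  exact ha.2 _ _ (Fin.rev_lt_rev.2 h)

/-! the matrices E, J, I -/
lemma Jk_eq (k t : ℕ) : Jk k t = 1 - Imn k k t := by
  ext i j
  simp only [Jk, Imn, Matrix.sub_apply, Matrix.one_apply, Fin.ext_iff]
  by_cases h : (i:ℕ) = j <;> by_cases h' : (i:ℕ) < t <;> simp [h, h'] <;> 
    (try simp [← h, h'])

lemma Imn_mul_apply {m n l t : ℕ} (M : Mat n l) (i : Fin m) (j : Fin l) :
    (Imn m n t * M) i j = if h : (i:ℕ) < t ∧ (i:ℕ) < n then M ⟨i, h.2⟩ j else 0 := by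
  rw [Matrix.mul_apply]
  split_ifs with h
  · rw [Finset.sum_eq_single ⟨i, h.2⟩]
    · simp [Imn, h.1]
    · intro b _ hb
      have : (i:ℕ) ≠ b := fun h => hb (Fin.ext h.symm)
      simp [Imn, this]
    · simp
  · apply Finset.sum_eq_zero
    intro x _
    have : ¬ ((i:ℕ) = x ∧ (i:ℕ) < t) := by
      rintro ⟨h1, h2⟩; exact h ⟨h2, h1 ▸ x.2⟩
    simp [Imn, this]

lemma Imn_transpose (m n t : ℕ) : (Imn m n t)ᵀ = Imn n m t := by
  ext i j
  simp only [Imn, Matrix.transpose_apply]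
  congr 1
  apply propext
  constructor <;> rintro ⟨h1, h2⟩ <;> exact ⟨h1.symm, by omega⟩

lemma mul_Imn_apply {m n l t : ℕ} (M : Mat l m) (i : Fin l) (j : Fin n) :
    (M * Imn m n t) i j = if h : (j:ℕ) < t ∧ (j:ℕ) < m then M i ⟨j, h.2⟩ else 0 := by
  have := Imn_mul_apply (t := t) (m := n) Mᵀ j i
  rw [← Imn_transpose, ← Matrix.transpose_mul] at this
  exact this

lemma Imn_mul_Imn {m n l t : ℕ} (h : t ≤ n) : Imn m n t * Imn n l t = Imn m l t := by
  ext i j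
  rw [Imn_mul_apply]
  by_cases hi : (i:ℕ) < t
  · rw [dif_pos ⟨hi, by omega⟩]; simp [Imn]
  · rw [dif_neg (by tauto)]; simp [Imn, hi]

/-! embPerm -/
lemma embPerm_lt {k t : ℕ} (h : t ≤ k) (τ : Equiv.Perm (Fin t)) (i : Fin k) (hi : (i:ℕ) < t) :
    embPerm h τ i = Fin.castLE h (τ ⟨i, hi⟩) := by
  have : i = Fin.castLEEmb h ⟨i, hi⟩ := by ext; simp
  conv_lhs => rw [this]
  rw [embPerm, Equiv.Perm.viaFintypeEmbedding_apply_image]; rfl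

lemma embPerm_ge {k t : ℕ} (h : t ≤ k) (τ : Equiv.Perm (Fin t)) (i : Fin k) (hi : t ≤ (i:ℕ)) :
    embPerm h τ i = i := by
  rw [embPerm, Equiv.Perm.viaFintypeEmbedding_apply_notMem_range]
  rintro ⟨x, rfl⟩
  simp at hi; omega

lemma embPerm_inv {k t : ℕ} (h : t ≤ k) (τ : Equiv.Perm (Fin t)) :
    (embPerm h τ)⁻¹ = embPerm h τ⁻¹ := by
  rw [inv_eq_iff_mul_eq_one]
  ext i
  by_cases hi : (i:ℕ) < t
  · rw [Equiv.Perm.mul_apply, embPerm_lt _ _ i hi, embPerm_lt]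
    · simp
    · simp
  · rw [Equiv.Perm.mul_apply, embPerm_ge _ _ i (by omega), embPerm_ge _ _ i (by omega)]; rfl

lemma embPerm_comm {m n t : ℕ} (hm : t ≤ m) (hn : t ≤ n) (τ : Equiv.Perm (Fin t)) :
    permMat m (embPerm hm τ) * Imn m n t = Imn m n t * permMat n (embPerm hn τ) := by
  ext i j
  rw [mul_Imn_apply, Imn_mul_apply]
  by_cases hi : (i:ℕ) < t <;> by_cases hj : (j:ℕ) < t
  · rw [dif_pos ⟨hj, by omega⟩, dif_pos ⟨hi, by omega⟩]
    simp [permMat, embPerm_lt, hj, Fin.ext_iff]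
  · rw [dif_neg (by tauto), dif_pos ⟨hi, by omega⟩]
    simp only [permMat]
    rw [embPerm_ge _ _ _ (by omega), if_neg]
    intro h; rw [← h] at hj; simp at hj; omega
  · rw [dif_pos ⟨hj, by omega⟩, dif_neg (by tauto)]
    simp only [permMat]
    rw [embPerm_lt _ _ _ (by simpa using hj), if_neg]
    intro h; rw [h] at hi; simp at hi
  · rw [dif_neg (by tauto), dif_neg (by tauto)]

lemma embPerm_J {k t : ℕ} (h : t ≤ k) (τ : Equiv.Perm (Fin t)) :
    permMat k (embPerm h τ) * Jk k t = Jk k t := by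
  ext i j
  rw [permMat_mul_apply, embPerm_inv]
  simp only [Jk]
  by_cases hi : (i:ℕ) < t
  · rw [embPerm_lt _ _ _ hi, if_neg, if_neg]
    · omega
    · have := (τ⁻¹ ⟨i, hi⟩).2
      simp only [Fin.val_castLE]; omega
  · rw [embPerm_ge _ _ _ (by omega)]
    
lemma J_embPerm {k t : ℕ} (h : t ≤ k) (τ : Equiv.Perm (Fin t)) :
    Jk k t * permMat k (embPerm h τ) = Jk k t := by
  rw [Jk_eq, Matrix.sub_mul, Matrix.one_mul, ← embPerm_comm h h]
  have := embPerm_J h τ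
  rwa [Jk_eq, Matrix.mul_sub, Matrix.mul_one] at this

/-! Uniqueness of Bruhat cells -/
lemma perm_eq_of_le {k : ℕ} (a b : Equiv.Perm (Fin k)) (h : ∀ j, a j ≤ b j) : a = b := by
  have hs : ∑ j, ((a j : Fin k) : ℕ) = ∑ j, ((b j : Fin k) : ℕ) := by
    rw [Equiv.sum_comp a (fun j : Fin k => (j:ℕ)), Equiv.sum_comp b (fun j : Fin k => (j:ℕ))]
  have := (Finset.sum_eq_sum_iff_of_le (fun j _ => by exact_mod_cast h j)).1 hs
  ext j
  exact this j (Finset.mem_univ _)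

lemma tri_diag_ne {k : ℕ} {a : Mat k k} (ha : a ∈ Bp k) (i : Fin k) : a i i ≠ 0 := by
  have h1 : a.det = ∏ i, a i i := Matrix.det_of_isUpperTriangular (fun i j h => ha.2 i j h)
  have h2 := (Matrix.isUnit_iff_isUnit_det _).1 ha.1
  rw [h1] at h2
  have := h2.ne_zero
  rw [Finset.prod_ne_zero_iff] at this
  exact this i (Finset.mem_univ _)

lemma bruhat_unique {k : ℕ} {w w' : Equiv.Perm (Fin k)} {x : Mat k k}
    (h : x ∈ dcPlus (permMat k w)) (h' : x ∈ dcPlus (permMat k w')) : w = w' := by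
  obtain ⟨b, hb, c, hc, rfl⟩ := h
  obtain ⟨b', hb', c', hc', h⟩ := h'
  have e1 : permMat k w * (c * c'⁻¹) = (b⁻¹ * b') * permMat k w' := by
    have h3 : b⁻¹ * (b * permMat k w * c) * c'⁻¹ = b⁻¹ * (b' * permMat k w' * c') * c'⁻¹ := by rw [h]
    calc permMat k w * (c * c'⁻¹) = (b⁻¹ * b) * permMat k w * (c * c'⁻¹) := by
          rw [(unit_inv hb.1).2, Matrix.one_mul]
      _ = b⁻¹ * (b * permMat k w * c) * c'⁻¹ := by simp only [Matrix.mul_assoc]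
      _ = b⁻¹ * (b' * permMat k w' * c') * c'⁻¹ := h3
      _ = (b⁻¹ * b') * permMat k w' * (c' * c'⁻¹) := by simp only [Matrix.mul_assoc]
      _ = _ := by rw [(unit_inv hc'.1).1, Matrix.mul_one]
  apply perm_eq_of_le
  intro j
  have hd := tri_diag_ne (Bp_mul hc (Bp_inv hc')) j
  have h2 := congrFun (congrFun e1 (w j)) j
  rw [permMat_mul_apply, mul_permMat_apply] at h2
  rw [show w⁻¹ (w j) = j by simp] at h2
  by_contra hlt
  push Not at hlt
  rw [h2] at hd
  exact hd ((Bp_mul (Bp_inv hb) hb').2 _ _ hlt)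


/-! Bruhat order by counting -/
lemma forall2_count {k : ℕ} {l1 l2 : List (Fin k)} (h : List.Forall₂ (· ≤ ·) l1 l2) (q : Fin k) :
    l1.countP (fun a => q ≤ a) ≤ l2.countP (fun a => q ≤ a) := by
  induction h with
  | nil => simp
  | @cons a b l1 l2 hab _ ih =>
    rw [List.countP_cons, List.countP_cons]
    by_cases h1 : q ≤ a
    · have : q ≤ b := h1.trans hab
      simp [h1, this, ih]
    · simp only [h1]; simp; omega

lemma count_forall2 {k : ℕ} {l1 l2 : List (Fin k)} (hl : l1.length = l2.length)
    (s1 : l1.Pairwise (· ≤ ·)) (s2 : l2.Pairwise (· ≤ ·))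
    (h : ∀ q : Fin k, l1.countP (fun a => q ≤ a) ≤ l2.countP (fun a => q ≤ a)) :
    List.Forall₂ (· ≤ ·) l1 l2 := by
  induction l1 generalizing l2 with
  | nil => cases l2 with
    | nil => simp
    | cons b l2 => simp at hl
  | cons a l1 ih => cases l2 with
    | nil => simp at hl
    | cons b l2 =>
      rw [List.pairwise_cons] at s1 s2
      simp only [List.length_cons, Nat.add_right_cancel_iff] at hl
      have hab : a ≤ b := by
        have h1 := h a
        have h2 : (a :: l1).countP (fun x => a ≤ x) = (a :: l1).length := by
          rw [List.countP_eq_length]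
          intro x hx
          rcases List.mem_cons.1 hx with rfl | hx
          · simp
          · simpa using s1.1 x hx
        have h3 : (b :: l2).countP (fun x => a ≤ x) ≤ (b :: l2).length := List.countP_le_length
        have h4 : (b :: l2).countP (fun x => a ≤ x) = (b :: l2).length := by
          simp only [List.length_cons] at *; omega
        rw [List.countP_eq_length] at h4
        simpa using h4 b (by simp)
      refine List.Forall₂.cons hab (ih hl s1.2 s2.2 ?_)
      intro q
      by_cases hq : q ≤ b
      · have h4 : l2.countP (fun x => q ≤ x) = l2.length := by
          rw [List.countP_eq_length]
          intro x hx
          simpa using hq.trans (s2.1 x hx)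
        rw [h4, ← hl]; exact List.countP_le_length
      · have := h q
        rw [List.countP_cons, List.countP_cons] at this
        have hqa : ¬ q ≤ a := fun h => hq (h.trans hab)
        simpa [hq, hqa] using this

lemma countP_sort {k : ℕ} (A : Finset (Fin k)) (q : Fin k) :
    (A.sort (· ≤ ·)).countP (fun a => q ≤ a) = (A.filter (fun a => q ≤ a)).card := by
  have : (A.sort (· ≤ ·) : Multiset (Fin k)) = A.val := Finset.sort_eq A (· ≤ ·)
  rw [Finset.card_def, Finset.filter_val, ← this]
  rw [Multiset.filter_coe, Multiset.coe_card, List.countP_eq_length_filter]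

lemma finsetLE_iff {k : ℕ} (A B : Finset (Fin k)) (h : A.card = B.card) :
    finsetLE A B ↔ ∀ q, (A.filter (fun a => q ≤ a)).card ≤ (B.filter (fun a => q ≤ a)).card := by
  simp only [← countP_sort]
  constructor
  · intro h q; exact forall2_count h q
  · intro h'
    exact count_forall2 (by simpa using h) (Finset.pairwise_sort _ _) (Finset.pairwise_sort _ _) h'

lemma bruhat_iff {k : ℕ} (y z : Equiv.Perm (Fin k)) :
    bruhatLE y z ↔ ∀ p q, (Finset.univ.filter (fun j => j ≤ p ∧ q ≤ y j)).card ≤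
      (Finset.univ.filter (fun j => j ≤ p ∧ q ≤ z j)).card := by
  have key : ∀ (y : Equiv.Perm (Fin k)) (p q : Fin k),
      (((Finset.Iic p).image y).filter (fun a => q ≤ a)).card =
      (Finset.univ.filter (fun j => j ≤ p ∧ q ≤ y j)).card := by
    intro y p q
    rw [Finset.filter_image, Finset.card_image_of_injective _ y.injective]
    congr 1
    ext j; simp
  unfold bruhatLE
  refine forall_congr' fun p => ?_
  rw [finsetLE_iff]
  · simp only [key]
  · rw [Finset.card_image_of_injective _ y.injective, Finset.card_image_of_injective _ z.injective]

/-! nonempty intersection implies Bruhat order -/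
lemma Bm_diag_ne {k : ℕ} {a : Mat k k} (ha : a ∈ Bm k) (i : Fin k) : a i i ≠ 0 :=
  tri_diag_ne (Bm_transpose ha) i

lemma bruhat_of_inter {k : ℕ} {y y' : Equiv.Perm (Fin k)} {g : Mat k k}
    (h : g ∈ dcPlus (permMat k y)) (h' : ∃ b ∈ Bm k, g = b * permMat k y') : bruhatLE y' y := by
  rw [bruhat_iff]
  intro p q
  obtain ⟨b, hb, b', hb', hg⟩ := h
  obtain ⟨c, hc, hg'⟩ := h'
  set S : Finset (Fin k) := Finset.univ.filter (fun j => j ≤ p ∧ q ≤ y' j) with hS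
  set T : Finset (Fin k) := Finset.univ.filter (fun j => j ≤ p ∧ q ≤ y j) with hT
  let M : Matrix S S ℂ := fun i j => g (y' i) j
  have hM : M = (Matrix.of fun (i : S) (l : T) => b (y' i) (y l)) * (Matrix.of fun (l : T) (j : S) => b' l j) := by
    ext i j
    have hi := i.2
    have hj := j.2
    simp only [hS, Finset.mem_filter, Finset.mem_univ, true_and] at hi hj
    change g (y' i) j = _
    rw [hg, Matrix.mul_assoc, Matrix.mul_apply, ← Equiv.sum_comp y]
    rw [Matrix.mul_apply]
    simp only [permMat_mul_apply, Matrix.of_apply]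
    rw [Finset.sum_coe_sort T (fun l => b (y' i) (y l) * b' l j)]
    symm
    rw [← Finset.sum_subset (Finset.subset_univ T)]
    · apply Finset.sum_congr rfl; intro x _; simp
    · intro l _ hl
      simp only [hT, Finset.mem_filter, Finset.mem_univ, true_and, not_and, not_le] at hl
      rw [show y⁻¹ (y l) = l by simp]
      by_cases h1 : l ≤ p
      · rw [hb.2 _ _ ((hl h1).trans_le hi.2), zero_mul]
      · rw [hb'.2 _ _ (hj.1.trans_lt (not_le.1 h1)), mul_zero]
  have hr1 : M.rank ≤ T.card := by
    rw [hM]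
    refine (Matrix.rank_mul_le_left _ _).trans ?_
    refine (Matrix.rank_le_card_width _).trans (by simp)
  have hu : IsUnit M := by
    rw [Matrix.isUnit_iff_isUnit_det]
    have hbt : M.BlockTriangular (fun i => OrderDual.toDual (y' i)) := by
      intro i j hij
      change g (y' i) j = 0
      rw [hg', mul_permMat_apply]
      exact hc.2 _ _ hij
    let _ : LinearOrder S := LinearOrder.lift' (fun i : S => OrderDual.toDual (y' i))
      (fun a b h => Subtype.ext (y'.injective h))
    rw [Matrix.det_of_isUpperTriangular (fun i j h => hbt h)]
    rw [isUnit_iff_ne_zero, Finset.prod_ne_zero_iff]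
    intro i _
    change g (y' i) i ≠ 0
    rw [hg', mul_permMat_apply]
    exact Bm_diag_ne hc _
  have := Matrix.rank_of_isUnit M hu
  rw [Fintype.card_coe] at this
  omega

/-! the combinatorial lemma -/
lemma card_lt_perm {k : ℕ} (y : Equiv.Perm (Fin k)) (P : Fin k → Prop) [DecidablePred P] :
    (Finset.univ.filter (fun j => P (y j))).card = (Finset.univ.filter P).card := by
  rw [← Finset.card_map y.toEmbedding]
  congr 1
  ext j; simp only [Finset.mem_map_equiv, Finset.mem_filter, Finset.mem_univ, true_and]
  simp

lemma bruhat_count' {k : ℕ} {z y : Equiv.Perm (Fin k)} (h : bruhatLE z y) (s p : ℕ) :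
    (Finset.univ.filter (fun j : Fin k => s ≤ (j:ℕ) ∧ ((z j : Fin k):ℕ) < p)).card ≤
    (Finset.univ.filter (fun j : Fin k => s ≤ (j:ℕ) ∧ ((y j : Fin k):ℕ) < p)).card := by
  have key : ∀ (y : Equiv.Perm (Fin k)),
    (Finset.univ.filter (fun j : Fin k => s ≤ (j:ℕ) ∧ ((y j : Fin k):ℕ) < p)).card
      + (Finset.univ.filter (fun j : Fin k => (j:ℕ) < s)).card 
    = (Finset.univ.filter (fun j : Fin k => (j:ℕ) < s ∧ p ≤ ((y j : Fin k):ℕ))).card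
      + (Finset.univ.filter (fun j : Fin k => (j:ℕ) < p)).card := by
    intro y
    have e1 := card_lt_perm y (fun j => (j:ℕ) < p)
    rw [← e1]
    rw [← Finset.card_union_of_disjoint, ← Finset.card_union_of_disjoint]
    · congr 1
      ext j; simp; omega
    · rw [Finset.disjoint_filter]; intros; omega
    · rw [Finset.disjoint_filter]; intros; omega
  have h1 := key z
  have h2 := key y
  have h3 : (Finset.univ.filter (fun j : Fin k => (j:ℕ) < s ∧ p ≤ ((z j : Fin k):ℕ))).card ≤
    (Finset.univ.filter (fun j : Fin k => (j:ℕ) < s ∧ p ≤ ((y j : Fin k):ℕ))).card := by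
    by_cases hp : p < k
    · by_cases hs : 0 < s
      · by_cases hk : s ≤ k
        · have := (bruhat_iff z y).1 h ⟨s - 1, by omega⟩ ⟨p, hp⟩
          simp only [Fin.le_def] at this
          convert this using 4 <;> omega
        · have := (bruhat_iff z y).1 h ⟨k - 1, by omega⟩ ⟨p, hp⟩
          simp only [Fin.le_def] at this
          convert this using 4 <;> omega
      · have : Finset.univ.filter (fun j : Fin k => (j:ℕ) < s ∧ p ≤ ((z j : Fin k):ℕ)) = ∅ := by
          rw [Finset.filter_eq_empty_iff]; intros; omega
        rw [this]; simp
    · have : Finset.univ.filter (fun j : Fin k => (j:ℕ) < s ∧ p ≤ ((z j : Fin k):ℕ)) = ∅ := by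
        rw [Finset.filter_eq_empty_iff]; intros; omega
      rw [this]; simp
  omega

lemma comb_count {k t : ℕ} {z y : Equiv.Perm (Fin k)} (h : bruhatLE z y) (hy : tailMono t y)
    (p q : ℕ) :
    (Finset.univ.filter (fun i : Fin k => t ≤ (i:ℕ) ∧ q ≤ ((y i : Fin k):ℕ) ∧ ((z i : Fin k):ℕ) < p)).card
      ≤ p - q := by
  obtain ⟨s, hs⟩ : ∃ s : ℕ, ∀ i : Fin k, (t ≤ (i:ℕ) ∧ q ≤ ((y i : Fin k):ℕ)) ↔ s ≤ (i:ℕ) := by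
    by_cases hex : ∃ i : ℕ, ∃ hi : i < k, t ≤ i ∧ q ≤ ((y ⟨i, hi⟩ : Fin k):ℕ)
    · classical
      refine ⟨Nat.find hex, fun i => ⟨fun hi => Nat.find_min' hex ⟨i.2, hi⟩, fun hi => ?_⟩⟩
      obtain ⟨h1, h2, h3⟩ := Nat.find_spec hex
      refine ⟨h2.trans hi, ?_⟩
      rcases hi.eq_or_lt with he | hlt
      · have : i = ⟨Nat.find hex, h1⟩ := Fin.ext he.symm
        rw [this]; exact h3
      · have := hy ⟨Nat.find hex, h1⟩ i hlt h2
        have : ((y ⟨Nat.find hex, h1⟩ : Fin k) : ℕ) < (y i : Fin k) := this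
        omega
    · refine ⟨k, fun i => ⟨fun hi => (hex ⟨i, i.2, hi⟩).elim, fun hi => ?_⟩⟩
      have := i.2; omega
  have e1 : (Finset.univ.filter (fun i : Fin k => t ≤ (i:ℕ) ∧ q ≤ ((y i : Fin k):ℕ) ∧ ((z i : Fin k):ℕ) < p))
     = (Finset.univ.filter (fun j : Fin k => s ≤ (j:ℕ) ∧ ((z j : Fin k):ℕ) < p)) := by
    ext i; simp only [Finset.mem_filter, Finset.mem_univ, true_and, ← hs, and_assoc]
  rw [e1]
  refine (bruhat_count' h s p).trans ?_
  have e2 : (Finset.univ.filter (fun j : Fin k => s ≤ (j:ℕ) ∧ ((y j : Fin k):ℕ) < p)).card ≤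
     (Finset.univ.filter (fun j : Fin k => q ≤ ((y j : Fin k):ℕ) ∧ ((y j : Fin k):ℕ) < p)).card := by
    apply Finset.card_le_card
    intro i; simp only [Finset.mem_filter, Finset.mem_univ, true_and, ← hs]; tauto
  refine e2.trans ?_
  rw [← Nat.card_Ico, ← Finset.card_image_of_injOn (f := fun j => ((y j : Fin k) : ℕ))]
  · apply Finset.card_le_card
    intro i; simp; rintro a h1 h2 rfl; exact ⟨h1, h2⟩
  · intro a _ b _ hab
    exact y.injective (Fin.ext hab)


/-! algebraic core of the forward inclusion -/
section alg
variable {m n : ℕ} {I : Mat m n} {I' : Mat n m} {E J b bi Ti : Mat m m} {E' J' D d Tn : Mat n n}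

lemma alg1 (hII' : I * I' = E) (hEI : E * I = I) (hJI : J * I = 0) (hIJ' : I * J' = 0)
    (hb : E * (b * E) = b * E) :
    (E + J * b * J) * I * (I' * b * I + J') = b * I := by
  have h1 : (E + J * b * J) * I = I := by
    rw [Matrix.add_mul, hEI, Matrix.mul_assoc, hJI, Matrix.mul_zero, add_zero]
  rw [h1, Matrix.mul_add, hIJ', add_zero, ← Matrix.mul_assoc, ← Matrix.mul_assoc, hII']
  calc E * b * I = E * (b * E) * I := by
        conv_lhs => rw [← hEI]
        simp only [Matrix.mul_assoc]
    _ = b * I := by rw [hb, Matrix.mul_assoc, hEI]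

lemma alg2 (hII' : I * I' = E) (hEI : E * I = I) (hJI : J * I = 0) (hIJ' : I * J' = 0)
    (hJ : J = 1 - E) (hJJ : J * J = J) (hEJ : E * J = 0)
    (hb : E * (b * E) = b * E) (hT : J * Ti = J) :
    (E + J * b * J) * I * (I' * b * Ti - J' * d * J' * D * I') + (E + J * b * J) * J * (J - I * D * I')
      = b * Ti := by
  have h1 : (E + J * b * J) * I = I := by
    rw [Matrix.add_mul, hEI, Matrix.mul_assoc, hJI, Matrix.mul_zero, add_zero]
  have h2 : (E + J * b * J) * J = J * b * J := by
    rw [Matrix.add_mul, hEJ, zero_add, Matrix.mul_assoc, hJJ]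
  have h3 : J * b * J = J * b := by
    have : J * b * E = 0 := by
      rw [hJ, Matrix.mul_assoc, Matrix.sub_mul, Matrix.one_mul, hb, sub_self]
    have e : J * b * J = J * b * (1 - E) := by rw [← hJ]
    rw [e, Matrix.mul_sub, this, sub_zero, Matrix.mul_one]
  have h4 : J * b * J * (J - I * D * I') = J * b * Ti := by
    have : J * (J - I * D * I') = J := by
      rw [Matrix.mul_sub, hJJ, Matrix.mul_assoc, ← Matrix.mul_assoc J, hJI, Matrix.zero_mul, sub_zero]
    rw [Matrix.mul_assoc, this, ← h3, Matrix.mul_assoc _ J Ti, hT, Matrix.mul_assoc _ J J, hJJ]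
  rw [h1, h2, h4, Matrix.mul_sub]
  have h5 : I * (J' * d * J' * D * I') = 0 := by
    simp only [← Matrix.mul_assoc, hIJ', Matrix.zero_mul]
  rw [h5, sub_zero, ← Matrix.mul_assoc, ← Matrix.mul_assoc, hII', ← Matrix.add_mul, ← Matrix.add_mul, hJ,
    add_sub_cancel, Matrix.one_mul]

lemma alg3 (hII' : I * I' = E) (hI'I : I' * I = E') (hEI : E * I = I)
    (hIJ' : I * J' = 0) (hJI : J * I = 0)
    (hJ' : J' = 1 - E') (hJJ' : J' * J' = J') (hEJ' : E' * J' = 0) (hJI' : J' * I' = 0)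
    (hb : E * (b * E) = b * E) (hbi : bi * b = 1) (hD : J' * (D * J') = D * J') (hT : Tn * J' = J') :
    (E' + J' * D * J') * J' * (I' * b * I + J') +
      (D * Tn * I' * bi * E - D * Tn * I' * bi * E * b * J) * I * (I' * b * I + J') = D * Tn := by
  have h1 : (E' + J' * D * J') * J' * (I' * b * I + J') = D * J' := by
    rw [Matrix.add_mul, hEJ', zero_add, Matrix.mul_assoc _ J' J', hJJ', Matrix.mul_add,
      Matrix.mul_assoc (J' * D) J' J', hJJ', Matrix.mul_assoc I', Matrix.mul_assoc (J' * D), 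
      ← Matrix.mul_assoc J' I', hJI', Matrix.zero_mul, Matrix.mul_zero, zero_add,
      Matrix.mul_assoc, hD]
  have h2 : (D * Tn * I' * bi * E - D * Tn * I' * bi * E * b * J) * I = D * Tn * I' * bi * I := by
    rw [Matrix.sub_mul, Matrix.mul_assoc _ J, hJI, Matrix.mul_zero, sub_zero, Matrix.mul_assoc _ E, hEI]
  have h3 : I * (I' * b * I + J') = b * I := by
    have := alg1 (I := I) (I' := I') hII' hEI hJI hIJ' hb
    have h1 : (E + J * b * J) * I = I := by
      rw [Matrix.add_mul, hEI, Matrix.mul_assoc, hJI, Matrix.mul_zero, add_zero]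
    rwa [h1] at this
  rw [h1, h2, Matrix.mul_assoc _ I, h3, ← Matrix.mul_assoc, Matrix.mul_assoc _ bi, hbi, Matrix.mul_one,
    Matrix.mul_assoc _ I', hI'I]
  have : D * J' = D * Tn * J' := by rw [Matrix.mul_assoc, hT]
  rw [this, ← Matrix.mul_add, hJ', sub_add_cancel, Matrix.mul_one]

lemma alg4 (hII' : I * I' = E) (hI'I : I' * I = E') (hEI : E * I = I) (hE'I' : E' * I' = I')
    (hI'E : I' * E = I')
    (hIJ' : I * J' = 0) (hJI : J * I = 0) (hEE : E * E = E) (hJ : J = 1 - E) (hJJ : J * J = J)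
    (hI'J : I' * J = 0)
    (hJ' : J' = 1 - E') (hJJ' : J' * J' = J') (hEJ' : E' * J' = 0) (hJI' : J' * I' = 0)
    (hb : E * (b * E) = b * E) (hbi : bi * b = 1) (hDd : D * d = 1) (hD : J' * (D * J') = D * J') 
    (hd : J' * (d * J') = d * J') (hT : J * Ti = J) (hTT : Tn * I' * Ti = I') (hETi : E * Ti = Ti * E) :
    (E' + J' * D * J') * J' * (I' * b * Ti - J' * d * J' * D * I') +
      (E' + J' * D * J') * I' * (J - I * D * I') +
      (D * Tn * I' * bi * E - D * Tn * I' * bi * E * b * J) * I * (I' * b * Ti - J' * d * J' * D * I') +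
      (D * Tn * I' * bi * E - D * Tn * I' * bi * E * b * J) * J * (J - I * D * I') = 0 := by
  have hEJ : E * J = 0 := by rw [hJ, Matrix.mul_sub, hEE, Matrix.mul_one, sub_self]
  have h1 : (E' + J' * D * J') * J' * (I' * b * Ti - J' * d * J' * D * I') = - (J' * D * I') := by
    have a1 : (E' + J' * D * J') * J' = D * J' := by
      rw [Matrix.add_mul, hEJ', zero_add, Matrix.mul_assoc, hJJ', Matrix.mul_assoc, hD]
    have a2 : D * J' * (I' * b * Ti) = 0 := by
      rw [Matrix.mul_assoc I', Matrix.mul_assoc D, ← Matrix.mul_assoc J' I', hJI', Matrix.zero_mul,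
        Matrix.mul_zero]
    have a3 : D * J' * (J' * d * J' * D * I') = J' * D * I' := by
      calc D * J' * (J' * d * J' * D * I') = D * ((J' * J') * (d * J')) * (D * I') := by
            simp only [Matrix.mul_assoc]
        _ = (D * d) * J' * (D * I') := by rw [hJJ', hd]; simp only [Matrix.mul_assoc]
        _ = _ := by rw [hDd, Matrix.one_mul, Matrix.mul_assoc]
    rw [a1, Matrix.mul_sub, a2, a3, zero_sub]
  have h2 : (E' + J' * D * J') * I' * (J - I * D * I') = - (E' * D * I') := by
    have a1 : (E' + J' * D * J') * I' = I' := by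
      rw [Matrix.add_mul, hE'I', Matrix.mul_assoc, hJI', Matrix.mul_zero, add_zero]
    rw [a1, Matrix.mul_sub, hI'J, zero_sub, ← Matrix.mul_assoc, ← Matrix.mul_assoc, hI'I]
  have b2 : (D * Tn * I' * bi * E - D * Tn * I' * bi * E * b * J) * I = D * Tn * I' * bi * I := by
    rw [Matrix.sub_mul, Matrix.mul_assoc _ J, hJI, Matrix.mul_zero, sub_zero, Matrix.mul_assoc _ E, hEI]
  have b3 : I * (I' * b * Ti - J' * d * J' * D * I') = E * b * Ti := by
    rw [Matrix.mul_sub]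
    simp only [← Matrix.mul_assoc, hIJ', Matrix.zero_mul, sub_zero, hII']
  have b4 : bi * (E * b * Ti) = Ti * E + bi * (E * b * J) := by
    have e1 : E * b * Ti = b * E * Ti + E * b * J := by
      have : E * b * Ti = E * b * E * Ti + E * b * J * Ti := by
        rw [← Matrix.add_mul, ← Matrix.mul_add, hJ, add_sub_cancel, Matrix.mul_one]
      rw [this, Matrix.mul_assoc _ J, hT, Matrix.mul_assoc E b E, hb]
    rw [e1, Matrix.mul_add, Matrix.mul_assoc b, ← Matrix.mul_assoc bi b, hbi, Matrix.one_mul, hETi]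
  have h3 : (D * Tn * I' * bi * E - D * Tn * I' * bi * E * b * J) * I * (I' * b * Ti - J' * d * J' * D * I')
      = D * I' + D * Tn * I' * bi * E * b * J := by
    rw [b2, Matrix.mul_assoc _ I, b3, Matrix.mul_assoc _ bi, b4, Matrix.mul_add, ← Matrix.mul_assoc,
      Matrix.mul_assoc D, Matrix.mul_assoc D, hTT, Matrix.mul_assoc D, hI'E]
    simp only [Matrix.mul_assoc]
  have h4 : (D * Tn * I' * bi * E - D * Tn * I' * bi * E * b * J) * J * (J - I * D * I') 
     = - (D * Tn * I' * bi * E * b * J) := by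
    have : J * (J - I * D * I') = J := by
      rw [Matrix.mul_sub, hJJ, Matrix.mul_assoc, ← Matrix.mul_assoc J, hJI, Matrix.zero_mul, sub_zero]
    rw [Matrix.mul_assoc _ J, this, Matrix.sub_mul, Matrix.mul_assoc _ E J, hEJ, Matrix.mul_zero, zero_sub,
      Matrix.mul_assoc _ J J, hJJ]
  rw [h1, h2, h3, h4]
  have : D * I' = E' * D * I' + J' * D * I' := by
    rw [← Matrix.add_mul, ← Matrix.add_mul, hJ', add_sub_cancel, Matrix.one_mul]
  rw [this]; abel
end alg

/-! block matrices -/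
def rb (m n : ℕ) (A : Mat n n) (B : Mat n m) (C : Mat m n) (D : Mat m m) : Mat (m+n) (m+n) :=
  Matrix.reindex (fe m n) (fe m n) (Matrix.fromBlocks A B C D)

lemma rb_mul {m n : ℕ} (A A' : Mat n n) (B B' : Mat n m) (C C' : Mat m n) (D D' : Mat m m) :
    rb m n A B C D * rb m n A' B' C' D' =
      rb m n (A * A' + B * C') (A * B' + B * D') (C * A' + D * C') (C * B' + D * D') := by
  simp only [rb, Matrix.reindex_apply]
  rw [Matrix.submatrix_mul_equiv, Matrix.fromBlocks_multiply]

lemma rb_one {m n : ℕ} : rb m n 1 0 0 1 = 1 := by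
  simp [rb]

lemma fe_inl_lt {m n : ℕ} (i j : Fin n) : fe m n (Sum.inl i) < fe m n (Sum.inl j) ↔ i < j := by
  rw [Fin.lt_def]; simp [fe]
lemma fe_inr_lt {m n : ℕ} (i j : Fin m) : fe m n (Sum.inr i) < fe m n (Sum.inr j) ↔ i < j := by
  rw [Fin.lt_def]; simp [fe]
lemma fe_inl_lt_inr {m n : ℕ} (i : Fin n) (j : Fin m) : fe m n (Sum.inl i) < fe m n (Sum.inr j) := by
  simp [fe, Fin.lt_def]; omega

lemma rb_upper {m n : ℕ} {A : Mat n n} {B : Mat n m} {D : Mat m m}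
    (hA : ∀ i j : Fin n, j < i → A i j = 0) (hD : ∀ i j : Fin m, j < i → D i j = 0) :
    ∀ i j, j < i → rb m n A B 0 D i j = 0 := by
  intro i j
  obtain ⟨i, rfl⟩ := (fe m n).surjective i
  obtain ⟨j, rfl⟩ := (fe m n).surjective j
  simp only [rb, Matrix.reindex_apply, Matrix.submatrix_apply, Equiv.symm_apply_apply]
  rcases i with i | i <;> rcases j with j | j
  · rw [fe_inl_lt]; exact hA i j
  · intro h; exact absurd (fe_inl_lt_inr i j) h.asymm
  · intro _; rfl
  · rw [fe_inr_lt]; exact hD i j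

lemma rb_lower {m n : ℕ} {A : Mat n n} {B : Mat m n} {D : Mat m m}
    (hA : ∀ i j : Fin n, i < j → A i j = 0) (hD : ∀ i j : Fin m, i < j → D i j = 0) :
    ∀ i j, i < j → rb m n A 0 B D i j = 0 := by
  intro i j
  obtain ⟨i, rfl⟩ := (fe m n).surjective i
  obtain ⟨j, rfl⟩ := (fe m n).surjective j
  simp only [rb, Matrix.reindex_apply, Matrix.submatrix_apply, Equiv.symm_apply_apply]
  rcases i with i | i <;> rcases j with j | j
  · rw [fe_inl_lt]; exact hA i j
  · intro _; rfl
  · intro h; exact absurd (fe_inl_lt_inr j i) h.asymm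
  · rw [fe_inr_lt]; exact hD i j

lemma embMat_isUnit (m n : ℕ) (x : Mat m n) : IsUnit (embMat m n x) := by
  apply IsUnit.of_mul_eq_one (rb m n (permMat n (revP n)) 0
    (- (permMat m (revP m) * x * permMat n (revP n))) (permMat m (revP m)))
  change rb m n _ _ _ _ * _ = _
  rw [rb_mul, ← rb_one]
  congr 1 <;> simp [rev_mul_rev, ← Matrix.mul_assoc]

lemma isUnit_factors {k : ℕ} {a b c : Mat k k} (h : IsUnit (a * b * c)) : IsUnit a ∧ IsUnit c := by
  simp only [Matrix.isUnit_iff_isUnit_det, IsUnit.mul_iff] at *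
  tauto


lemma conj_apply {k : ℕ} (u : Equiv.Perm (Fin k)) (L : Mat k k) (i j : Fin k) :
    (permMat k u * L * permMat k u⁻¹) i j = L (u⁻¹ i) (u⁻¹ j) := by
  rw [mul_permMat_apply, permMat_mul_apply]

lemma Jk_mul_apply {k l t : ℕ} (M : Mat k l) (i : Fin k) (j : Fin l) :
    (Jk k t * M) i j = if t ≤ (i:ℕ) then M i j else 0 := by
  rw [Jk_eq, Matrix.sub_mul, Matrix.one_mul, Matrix.sub_apply, Imn_mul_apply]
  by_cases h : (i:ℕ) < t
  · rw [dif_pos ⟨h, i.2⟩, if_neg (by omega)]; simp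
  · rw [dif_neg (by tauto), if_pos (by omega)]; simp

lemma mul_Jk_apply {k l t : ℕ} (M : Mat l k) (i : Fin l) (j : Fin k) :
    (M * Jk k t) i j = if t ≤ (j:ℕ) then M i j else 0 := by
  rw [Jk_eq, Matrix.mul_sub, Matrix.mul_one, Matrix.sub_apply, mul_Imn_apply]
  by_cases h : (j:ℕ) < t
  · rw [dif_pos ⟨h, j.2⟩, if_neg (by omega)]; simp
  · rw [dif_neg (by tauto), if_pos (by omega)]; simp

lemma EJ_apply {k t : ℕ} (D : Mat k k) (i j : Fin k) :
    (Imn k k t + Jk k t * D * Jk k t) i j =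
      if t ≤ (i:ℕ) ∧ t ≤ (j:ℕ) then D i j else if i = j then 1 else 0 := by
  rw [Matrix.add_apply, mul_Jk_apply, Jk_mul_apply]
  simp only [Imn, Fin.ext_iff]
  by_cases h1 : t ≤ (i:ℕ) <;> by_cases h2 : t ≤ (j:ℕ) <;> by_cases h3 : (i:ℕ) = j <;>
    simp only [h1, h2, h3, true_and, false_and, and_true, and_false, if_true, if_false, zero_add, add_zero] <;>
    (try rw [if_neg (by omega)]) <;> (try rw [if_pos (by omega)]) <;> (try simp) <;> (try omega)

lemma tail_conj_lower {k t : ℕ} {u : Equiv.Perm (Fin k)} (hu : tailMono t u) {D : Mat k k}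
    (hD : ∀ i j : Fin k, i < j → D i j = 0) (i j : Fin k) (hij : i < j) :
    (permMat k u * (Imn k k t + Jk k t * D * Jk k t) * permMat k u⁻¹) i j = 0 := by
  rw [conj_apply, EJ_apply]
  split_ifs with h1 h2
  · apply hD
    by_contra hc
    rcases (not_lt.1 hc).eq_or_lt with h | h
    · have := u⁻¹.injective h; omega
    · have := hu _ _ h h1.2
      simp at this; omega
  · have := u⁻¹.injective h2; omega
  · rfl

lemma tail_conj_upper {k t : ℕ} {u : Equiv.Perm (Fin k)} (hu : tailMono t u) {D : Mat k k}
    (hD : ∀ i j : Fin k, j < i → D i j = 0) (i j : Fin k) (hij : j < i) :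
    (permMat k u * (Imn k k t + Jk k t * D * Jk k t) * permMat k u⁻¹) i j = 0 := by
  rw [conj_apply, EJ_apply]
  split_ifs with h1 h2
  · apply hD
    by_contra hc
    rcases (not_lt.1 hc).eq_or_lt with h | h
    · have := u⁻¹.injective h; omega
    · have := hu _ _ h h1.1
      simp at this; omega
  · have := u⁻¹.injective h2; omega
  · rfl

lemma IbI_apply {m n t : ℕ} (b : Mat m m) (i j : Fin n) :
    (Imn n m t * b * Imn m n t) i j =
      if h : ((i:ℕ) < t ∧ (i:ℕ) < m) ∧ ((j:ℕ) < t ∧ (j:ℕ) < m) then b ⟨i, h.1.2⟩ ⟨j, h.2.2⟩ else 0 := by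
  rw [mul_Imn_apply]
  simp only [Imn_mul_apply]
  split_ifs <;> first | rfl | tauto

lemma head_conj_upper {m n t : ℕ} {v : Equiv.Perm (Fin n)} (hv : headMono t v) {b : Mat m m}
    (hb : ∀ i j : Fin m, j < i → b i j = 0) (i j : Fin n) (hij : j < i) :
    (permMat n v * (Imn n m t * b * Imn m n t + Jk n t) * permMat n v⁻¹) i j = 0 := by
  rw [conj_apply, Matrix.add_apply, IbI_apply]
  have hne : v⁻¹ i ≠ v⁻¹ j := fun h => by have := v⁻¹.injective h; omega
  have : Jk n t (v⁻¹ i) (v⁻¹ j) = 0 := by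
    simp only [Jk]; rw [if_neg]; rintro ⟨h, _⟩; exact hne (Fin.ext h)
  rw [this, add_zero]
  split_ifs with h1
  · apply hb
    by_contra hc
    have hc' : ¬ ((v⁻¹ j : Fin n) : ℕ) < ((v⁻¹ i : Fin n) : ℕ) := hc
    have hne' : ((v⁻¹ i : Fin n) : ℕ) ≠ ((v⁻¹ j : Fin n) : ℕ) := fun h => hne (Fin.ext h)
    have h : v⁻¹ i < v⁻¹ j := Fin.lt_def.2 (by omega)
    have := hv _ _ h h1.2.1
    simp at this; omega
  · rfl

lemma head_conj_lower {m n t : ℕ} {v : Equiv.Perm (Fin n)} (hv : headMono t v) {b : Mat m m}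
    (hb : ∀ i j : Fin m, i < j → b i j = 0) (i j : Fin n) (hij : i < j) :
    (permMat n v * (Jk n t - Imn n m t * b * Imn m n t) * permMat n v⁻¹) i j = 0 := by
  rw [conj_apply, Matrix.sub_apply, IbI_apply]
  have hne : v⁻¹ i ≠ v⁻¹ j := fun h => by have := v⁻¹.injective h; omega
  have : Jk n t (v⁻¹ i) (v⁻¹ j) = 0 := by
    simp only [Jk]; rw [if_neg]; rintro ⟨h, _⟩; exact hne (Fin.ext h)
  rw [this, zero_sub, neg_eq_zero]
  split_ifs with h1
  · apply hb
    by_contra hc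
    have hc' : ¬ ((v⁻¹ i : Fin n) : ℕ) < ((v⁻¹ j : Fin n) : ℕ) := hc
    have hne' : ((v⁻¹ i : Fin n) : ℕ) ≠ ((v⁻¹ j : Fin n) : ℕ) := fun h => hne (Fin.ext h)
    have h : v⁻¹ j < v⁻¹ i := Fin.lt_def.2 (by omega)
    have := hv _ _ h h1.1.1
    simp at this; omega
  · rfl

lemma EbE {k t : ℕ} {b : Mat k k} (hb : ∀ i j : Fin k, j < i → b i j = 0) :
    Imn k k t * (b * Imn k k t) = b * Imn k k t := by
  ext i j
  rw [Imn_mul_apply]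
  simp only [mul_Imn_apply]
  split_ifs with h1 h2 h2
  · rfl
  · rfl
  · symm; apply hb; rw [Fin.lt_def]; simp; omega
  · rfl

lemma JDJ {k t : ℕ} {b : Mat k k} (hb : ∀ i j : Fin k, i < j → b i j = 0) :
    Jk k t * (b * Jk k t) = b * Jk k t := by
  ext i j
  rw [Jk_mul_apply, mul_Jk_apply]
  split_ifs with h1 h2 h2
  · rfl
  · rfl
  · symm; apply hb; rw [Fin.lt_def]; omega
  · rfl

lemma JI {k l t : ℕ} (h : t ≤ k) : Jk k t * Imn k l t = 0 := by
  rw [Jk_eq, Matrix.sub_mul, Imn_mul_Imn h, Matrix.one_mul, sub_self]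
lemma IJ {k l t : ℕ} (h : t ≤ k) : Imn l k t * Jk k t = 0 := by
  rw [Jk_eq, Matrix.mul_sub, Imn_mul_Imn h, Matrix.mul_one, sub_self]
lemma JJ {k t : ℕ} (h : t ≤ k) : Jk k t * Jk k t = Jk k t := by
  have : Jk k t * Jk k t = Jk k t * (1 - Imn k k t) := by rw [← Jk_eq]
  rw [this, Matrix.mul_sub, JI h, Matrix.mul_one, sub_zero]

lemma core {m n t : ℕ} (htm : t ≤ m) (htn : t ≤ n) (τ : Equiv.Perm (Fin t))
    {b : Mat m m} {D : Mat n n} (hb : b ∈ Bp m) (hD : D ∈ Bm n) :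
    ∃ X Y, rb m n (D * permMat n (embPerm htn τ)) 0 (b * Imn m n t) (b * permMat m (embPerm htm τ)⁻¹) =
      rb m n (Imn n n t + Jk n t * D * Jk n t) X 0 (Imn m m t + Jk m t * b * Jk m t) *
      rb m n (Jk n t) (Imn n m t) (Imn m n t) (Jk m t) *
      rb m n (Imn n m t * b * Imn m n t + Jk n t) Y 0 (Jk m t - Imn m n t * D * Imn n m t) := by
  refine ⟨D * permMat n (embPerm htn τ) * Imn n m t * b⁻¹ * Imn m m t 
      - D * permMat n (embPerm htn τ) * Imn n m t * b⁻¹ * Imn m m t * b * Jk m t,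
    Imn n m t * b * permMat m (embPerm htm τ)⁻¹ - Jk n t * D⁻¹ * Jk n t * D * Imn n m t, ?_⟩
  have hbi := (unit_inv hb.1).2
  have hDi := (unit_inv hD.1).1
  have hTi : Jk m t * permMat m (embPerm htm τ)⁻¹ = Jk m t := by rw [embPerm_inv]; exact J_embPerm _ _
  have hTT : permMat n (embPerm htn τ) * Imn n m t * permMat m (embPerm htm τ)⁻¹ = Imn n m t := by
    rw [embPerm_comm htn htm, Matrix.mul_assoc, permMat_mul_inv, Matrix.mul_one]
  have hET : Imn m m t * permMat m (embPerm htm τ)⁻¹ = permMat m (embPerm htm τ)⁻¹ * Imn m m t := by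
    rw [embPerm_inv, embPerm_comm htm htm]
  rw [rb_mul, rb_mul]
  simp only [Matrix.mul_zero, Matrix.zero_mul, add_zero, zero_add]
  congr 1
  · rw [Matrix.add_mul]; symm
    exact alg3 (Imn_mul_Imn htn) (Imn_mul_Imn htm) (Imn_mul_Imn htm) (IJ htn) (JI htm)
      (Jk_eq _ _) (JJ htn) (IJ htn) (JI htn) (EbE hb.2) hbi (JDJ hD.2) (embPerm_J _ _)
  · rw [Matrix.add_mul ((_ + _) * _), Matrix.add_mul ((_ + _) * _)]
    have := alg4 (Imn_mul_Imn (m := m) (l := m) htn) (Imn_mul_Imn (m := n) (l := n) htm)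
      (Imn_mul_Imn htm) (Imn_mul_Imn htn) (Imn_mul_Imn htm) (IJ htn)
      (JI htm) (Imn_mul_Imn htm) (Jk_eq _ _) (JJ htm) (IJ htm) (Jk_eq _ _) (JJ htn) (IJ htn) (JI htn)
      (EbE hb.2) hbi hDi (JDJ hD.2) (JDJ (Bm_inv hD).2) hTi hTT hET
    rw [← this]; abel
  · symm; exact alg1 (Imn_mul_Imn htn) (Imn_mul_Imn htm) (JI htm) (IJ htn) (EbE hb.2)
  · symm; exact alg2 (Imn_mul_Imn htn) (Imn_mul_Imn htm) (JI htm) (IJ htn) (Jk_eq _ _) (JJ htm) (IJ htm)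
      (EbE hb.2) hTi

lemma rb_diag_mul {m n : ℕ} (P A : Mat n n) (B : Mat n m) (C : Mat m n) (Q D : Mat m m) :
    rb m n P 0 0 Q * rb m n A B C D = rb m n (P * A) (P * B) (Q * C) (Q * D) := by
  rw [rb_mul]; simp
lemma rb_mul_diag {m n : ℕ} (P A : Mat n n) (B : Mat n m) (C : Mat m n) (Q D : Mat m m) :
    rb m n A B C D * rb m n P 0 0 Q = rb m n (A * P) (B * Q) (C * P) (D * Q) := by
  rw [rb_mul]; simp

lemma upper_mul {k : ℕ} {a b : Mat k k} (ha : ∀ i j : Fin k, j < i → a i j = 0)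
   (hb : ∀ i j : Fin k, j < i → b i j = 0) : ∀ i j : Fin k, j < i → (a * b) i j = 0 := by
  have h1 : BlockTriangular a id := fun i j h => ha i j h
  have h2 : BlockTriangular b id := fun i j h => hb i j h
  exact fun i j h => (h1.mul h2) h

lemma rev_conj_upper {k : ℕ} {a : Mat k k} (ha : ∀ i j : Fin k, i < j → a i j = 0) :
   ∀ i j : Fin k, j < i → (permMat k (revP k) * a * permMat k (revP k)) i j = 0 := by
  intro i j h
  rw [rev_conj_apply]
  exact ha _ _ (Fin.rev_lt_rev.2 h)

lemma assoc_aux {k : ℕ} {A dg L dgi K dh dhi R A' : Mat k k} (hdg : dgi * dg = 1) (hdh : dh * dhi = 1) :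
    A * (dg * (L * K * R) * dh) * A' = (A * (dg * L * dgi)) * (dg * K * dh) * ((dhi * R * dh) * A') := by
  have e1 : (A * (dg * L * dgi)) * (dg * K * dh) * ((dhi * R * dh) * A') =
      A * (dg * L * (dgi * dg) * K * (dh * dhi) * R * dh) * A' := by simp only [Matrix.mul_assoc]
  rw [e1, hdg, hdh, Matrix.mul_one, Matrix.mul_one]
  simp only [Matrix.mul_assoc]

lemma forward {m n t : ℕ} (htm : t ≤ m) (htn : t ≤ n)
    {y : Equiv.Perm (Fin m)} {v : Equiv.Perm (Fin n)}
    {z : Equiv.Perm (Fin m)} {u : Equiv.Perm (Fin n)}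
    (hy : tailMono t y) (hv : headMono t v) (hz : headMono t z) (hu : tailMono t u)
    {x : Mat m n} (hx : x ∈ Pt m n t htm htn y v z u) :
    embMat m n x ∈ dcPlus (wBlock m n t y v z u) := by
  obtain ⟨τ, -, -, g, ⟨⟨b1, hb1, b, hb, hg⟩, c, hc, hg'⟩, h, ⟨⟨_, ⟨d, hd, d', hd', rfl⟩, hh⟩, e, he, hh'⟩, hx⟩ := hx
  have hD := Bm_inv hd
  obtain ⟨X, Y, hcore⟩ := core htm htn τ hb hD
  set Tm := embPerm htm τ
  set Tn := embPerm htn τ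
  let rn := permMat n (revP n)
  let rm := permMat m (revP m)
  let pu := permMat n u
  let py := permMat m y
  have hui : pu * permMat n u⁻¹ = 1 := permMat_mul_inv _ _
  have hembM : embMat m n x = rb m n (rn * d'⁻¹ * rn) 0 0 b1 * 
     (rb m n (rn * pu) 0 0 py * rb m n (d⁻¹ * permMat n Tn) 0 (b * Imn m n t) (b * permMat m Tm⁻¹) *
      rb m n (permMat n v⁻¹) 0 0 (permMat m z⁻¹ * rm)) * rb m n e 0 0 (rm * c⁻¹ * rm) := by
    rw [rb_diag_mul, rb_mul_diag, rb_diag_mul, rb_mul_diag]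
    simp only [Matrix.mul_zero, Matrix.zero_mul]
    change rb m n _ _ _ _ = _
    congr 1
    · symm
      have : (d'⁻¹ * pu * d⁻¹ * permMat n Tn) * h = 1 := by
        rw [hh]
        calc d'⁻¹ * pu * d⁻¹ * permMat n Tn * (permMat n Tn⁻¹ * (d * permMat n u⁻¹ * d'))
            = d'⁻¹ * (pu * ((d⁻¹ * ((permMat n Tn * permMat n Tn⁻¹) * d)) * permMat n u⁻¹)) * d' := by
              simp only [Matrix.mul_assoc]
          _ = 1 := by
            rw [permMat_mul_inv, Matrix.one_mul, (unit_inv hd.1).2, Matrix.one_mul, hui, Matrix.mul_one,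
              (unit_inv hd'.1).2]
      calc rn * d'⁻¹ * rn * (rn * pu * (d⁻¹ * permMat n Tn) * permMat n v⁻¹) * e 
          = rn * (d'⁻¹ * (rn * (rn * (pu * (d⁻¹ * (permMat n Tn * (permMat n v⁻¹ * e))))))) := by
            simp only [Matrix.mul_assoc]
        _ = rn * ((d'⁻¹ * pu * d⁻¹ * permMat n Tn) * h) := by
            rw [rev_mul_rev', ← hh']; simp only [Matrix.mul_assoc]
        _ = rn := by rw [this, Matrix.mul_one]
    · rw [hx, hg, hh']; simp only [Matrix.mul_assoc]; rfl
    · have e1 : (b1 * permMat m y * b) * permMat m Tm⁻¹ * permMat m z⁻¹ = c := by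
        rw [← hg, hg', permMat_mul]
        calc c * (permMat m z * permMat m Tm) * permMat m Tm⁻¹ * permMat m z⁻¹ 
            = c * (permMat m z * (permMat m Tm * permMat m Tm⁻¹) * permMat m z⁻¹) := by
              simp only [Matrix.mul_assoc]
          _ = c := by rw [permMat_mul_inv, Matrix.mul_one, permMat_mul_inv, Matrix.mul_one]
      symm
      calc b1 * (py * (b * permMat m Tm⁻¹) * (permMat m z⁻¹ * rm)) * (rm * c⁻¹ * rm)
          = ((b1 * permMat m y * b) * permMat m Tm⁻¹ * permMat m z⁻¹) * (rm * (rm * (c⁻¹ * rm))) := by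
            simp only [Matrix.mul_assoc]; rfl
        _ = rm := by rw [e1, rev_mul_rev', ← Matrix.mul_assoc, (unit_inv hc.1).1, Matrix.one_mul]
  let L1 := Imn n n t + Jk n t * d⁻¹ * Jk n t
  let L2 := Imn m m t + Jk m t * b * Jk m t
  let R1 := Imn n m t * b * Imn m n t + Jk n t
  let R2 := Jk m t - Imn m n t * d⁻¹ * Imn n m t
  have hwb : wBlock m n t y v z u = rb m n (rn * pu) 0 0 py * 
      rb m n (Jk n t) (Imn n m t) (Imn m n t) (Jk m t) * rb m n (permMat n v⁻¹) 0 0 (permMat m z⁻¹ * rm) := by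
    rw [rb_diag_mul, rb_mul_diag]
    simp only [wBlock, rb, Matrix.mul_assoc]; rfl
  let A := rb m n (rn * d'⁻¹ * rn) 0 0 b1
  let A' := rb m n e 0 0 (rm * c⁻¹ * rm)
  let dg := rb m n (rn * pu) 0 0 py
  let dgi := rb m n (permMat n u⁻¹ * rn) 0 0 (permMat m y⁻¹)
  let dh := rb m n (permMat n v⁻¹) 0 0 (permMat m z⁻¹ * rm)
  let dhi := rb m n (permMat n v) 0 0 (rm * permMat m z)
  have hdg : dgi * dg = 1 := by
    simp only [dgi, dg]; rw [rb_diag_mul, ← rb_one]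
    congr 1
    · rw [Matrix.mul_assoc, rev_mul_rev', permMat_inv_mul]
    · simp
    · simp
    · exact permMat_inv_mul _ _
  have hdh : dh * dhi = 1 := by
    simp only [dhi, dh]; rw [rb_diag_mul, ← rb_one]
    congr 1
    · exact permMat_inv_mul _ _
    · simp
    · simp
    · rw [Matrix.mul_assoc, rev_mul_rev', permMat_inv_mul]
  let L := rb m n L1 X 0 L2
  let R := rb m n R1 Y 0 R2
  have hfin : embMat m n x = (A * (dg * L * dgi)) * wBlock m n t y v z u * ((dhi * R * dh) * A') := by
    rw [hembM, hcore, hwb]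
    exact assoc_aux hdg hdh
  have hun := embMat_isUnit m n x
  rw [hfin] at hun
  obtain ⟨hu1, hu2⟩ := isUnit_factors hun
  refine ⟨_, ⟨hu1, ?_⟩, _, ⟨hu2, ?_⟩, hfin⟩
  · apply upper_mul
    · exact rb_upper (rev_conj_upper (Bm_inv hd').2) hb1.2
    · have : dg * L * dgi = rb m n (rn * (pu * L1 * permMat n u⁻¹) * rn) (rn * pu * X * permMat m y⁻¹) 0
          (py * L2 * permMat m y⁻¹) := by
        simp only [dg, L, dgi]
        rw [rb_diag_mul, rb_mul_diag]
        simp only [Matrix.mul_zero, Matrix.zero_mul, Matrix.mul_assoc]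
      rw [this]
      exact rb_upper (rev_conj_upper (tail_conj_lower hu hD.2)) (tail_conj_upper hy hb.2)
  · apply upper_mul
    · have : dhi * R * dh = rb m n (permMat n v * R1 * permMat n v⁻¹) (permMat n v * Y * (permMat m z⁻¹ * rm)) 0
          (rm * (permMat m z * R2 * permMat m z⁻¹) * rm) := by
        simp only [dhi, R, dh]
        rw [rb_diag_mul, rb_mul_diag]
        simp only [Matrix.mul_zero, Matrix.zero_mul, Matrix.mul_assoc]
      rw [this]
      exact rb_upper (head_conj_upper hv hb.2) (rev_conj_upper (head_conj_lower hz hD.2))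
    · exact rb_upper he.2 (rev_conj_upper (Bm_inv hc).2)


/-! Gaussian elimination -/
def goodRow {m n : ℕ} (s : Mat m n) (i : Fin m) : Prop :=
  ∀ l, s i l ≠ 0 → s i l = 1 ∧ (∀ l', l' ≠ l → s i l' = 0) ∧ ∀ i', i' ≠ i → s i' l = 0

def fixE (k t : ℕ) (c : Mat k k) : Prop := c * Imn k k t = Imn k k t ∧ Imn k k t * c = Imn k k t

lemma fixE_mul {k t : ℕ} {a b : Mat k k} (ha : fixE k t a) (hb : fixE k t b) : fixE k t (a * b) := by
  constructor
  · rw [Matrix.mul_assoc, hb.1, ha.1]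
  · rw [← Matrix.mul_assoc, ha.2, hb.2]

lemma fixE_one (k t : ℕ) : fixE k t 1 := ⟨Matrix.one_mul _, Matrix.mul_one _⟩

lemma fixE_inv {k t : ℕ} {a : Mat k k} (hu : IsUnit a) (ha : fixE k t a) : fixE k t a⁻¹ := by
  constructor
  · conv_lhs => rw [← ha.1, ← Matrix.mul_assoc, (unit_inv hu).2, Matrix.one_mul]
  · conv_lhs => rw [← ha.2, Matrix.mul_assoc, (unit_inv hu).1, Matrix.mul_one]

lemma fixE_iff {k t : ℕ} {c : Mat k k} :
    fixE k t c ↔ ∀ i j : Fin k, ((i:ℕ) < t ∨ (j:ℕ) < t) → c i j = if i = j then 1 else 0 := by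
  constructor
  · rintro ⟨h1, h2⟩ i j (h | h)
    · have := congrFun (congrFun h2 i) j
      rw [Imn_mul_apply, dif_pos ⟨h, i.2⟩] at this
      simpa [Imn, h, Fin.ext_iff] using this
    · have := congrFun (congrFun h1 i) j
      rw [mul_Imn_apply, dif_pos ⟨h, j.2⟩] at this
      rw [show c i j = _ from this]
      by_cases h3 : i = j
      · subst h3; simp [Imn, h]
      · have : (i:ℕ) ≠ j := fun h => h3 (Fin.ext h)
        simp [Imn, h3, this]
  · intro h
    constructor
    · ext i j
      rw [mul_Imn_apply]
      split_ifs with h1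
      · change c i j = _
        rw [h i j (Or.inr h1.1)]
        by_cases h3 : i = j
        · subst h3; simp [Imn, h1]
        · have : (i:ℕ) ≠ j := fun h => h3 (Fin.ext h)
          simp [Imn, h3, this]
      · simp only [Imn]; rw [if_neg]; omega
    · ext i j
      rw [Imn_mul_apply]
      split_ifs with h1
      · change c i j = _
        rw [h i j (Or.inl h1.1)]
        by_cases h3 : i = j
        · subst h3; simp [Imn, h1]
        · have : (i:ℕ) ≠ j := fun h => h3 (Fin.ext h)
          simp [Imn, h3, this]
      · simp only [Imn]; rw [if_neg]; omega

lemma mem_Bp_of {k : ℕ} {c : Mat k k} (h : ∀ i j : Fin k, j < i → c i j = 0) (hd : ∀ i, c i i ≠ 0) :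
    c ∈ Bp k := by
  refine ⟨?_, h⟩
  rw [Matrix.isUnit_iff_isUnit_det, Matrix.det_of_isUpperTriangular (fun i j hh => h i j hh),
    isUnit_iff_ne_zero, Finset.prod_ne_zero_iff]
  exact fun i _ => hd i

lemma mem_Bm_of {k : ℕ} {c : Mat k k} (h : ∀ i j : Fin k, i < j → c i j = 0) (hd : ∀ i, c i i ≠ 0) :
    c ∈ Bm k := by
  have := Bp_transpose (mem_Bp_of (c := cᵀ) (fun i j hh => h j i hh) hd)
  rwa [Matrix.transpose_transpose] at this

lemma Bp_one (k : ℕ) : (1 : Mat k k) ∈ Bp k :=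
  mem_Bp_of (fun i j h => Matrix.one_apply_ne h.ne') (fun i => by simp)
lemma Bm_one (k : ℕ) : (1 : Mat k k) ∈ Bm k :=
  mem_Bm_of (fun i j h => Matrix.one_apply_ne h.ne) (fun i => by simp)

lemma elim_step {m n t : ℕ} {x : Mat m n} (hx : ∀ (i : Fin m) (j : Fin n), (j:ℕ) < t → t ≤ (i:ℕ) → x i j = 0)
    (r : Fin m) (hr : t ≤ (r:ℕ)) (hg : ∀ i, i < r → goodRow x i) :
    ∃ c ∈ Bm m, ∃ e ∈ Bp n, fixE m t c ∧ fixE n t e ∧ ∀ i, i ≤ r → goodRow (c * x * e) i := by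
  by_cases hz : ∀ l, x r l = 0
  · refine ⟨1, Bm_one _, 1, Bp_one _, fixE_one _ _, fixE_one _ _, ?_⟩
    rw [Matrix.one_mul, Matrix.mul_one]
    intro i hi
    rcases hi.eq_or_lt with rfl | hi
    · intro l hl; exact absurd (hz l) hl
    · exact hg i hi
  · push Not at hz
    obtain ⟨j, hj, hmin⟩ := WellFounded.has_min (wellFounded_lt (α := Fin n)) {l | x r l ≠ 0} hz
    have hmin : ∀ l, l < j → x r l = 0 := by
      intro l hl; by_contra h; exact hmin l h hl
    have hj : x r j ≠ 0 := hj
    have htj : t ≤ (j:ℕ) := by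
      by_contra h; exact hj (hx r j (by omega) hr)
    let a : Fin m → ℂ := fun i => if i = r then (x r j)⁻¹ - 1 else if r < i then - x i j / x r j else 0
    let β : Fin n → ℂ := fun l => if j < l then - x r l / x r j else 0
    let c : Mat m m := 1 + Matrix.of fun i k => if k = r then a i else 0
    let e : Mat n n := 1 + Matrix.of fun k l => if k = j then β l else 0
    have hcx : ∀ i l, (c * x) i l = x i l + a i * x r l := by
      intro i l
      simp only [c, Matrix.add_mul, Matrix.one_mul, Matrix.add_apply]
      congr 1
      rw [Matrix.mul_apply, Finset.sum_eq_single r]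
      · simp
      · intro b _ hb; simp [hb]
      · simp
    have hy : ∀ i l, (c * x * e) i l = (x i l + a i * x r l) + (x i j + a i * x r j) * β l := by
      intro i l
      simp only [e, Matrix.mul_add, Matrix.mul_one, Matrix.add_apply, hcx]
      congr 1
      rw [Matrix.mul_apply, Finset.sum_eq_single j]
      · simp [hcx]
      · intro b _ hb; simp [hb]
      · simp
    have hyr : ∀ l, (c * x * e) r l = if l = j then 1 else 0 := by
      intro l
      rw [hy]
      simp only [a, β, if_true]
      rcases lt_trichotomy l j with h | h | h
      · simp [h.ne, h.asymm, hmin l h]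
      · subst h; simp; field_simp; ring
      · simp [h.ne', h]; field_simp; ring
    have hxj : ∀ i, i < r → x i j = 0 := by
      intro i hi
      by_contra h
      exact hj ((hg i hi j h).2.2 r hi.ne')
    have hylt : ∀ i l, i < r → (c * x * e) i l = x i l := by
      intro i l hi
      rw [hy, hxj i hi]
      simp [a, hi.ne, hi.asymm]
    have hygt : ∀ i l, r < i → (c * x * e) i l = x i l - x i j * x r l / x r j := by
      intro i l hi
      rw [hy]
      have : x i j + a i * x r j = 0 := by simp [a, hi.ne', hi]; field_simp; ring
      rw [this]
      simp [a, hi.ne', hi]; ring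
    refine ⟨c, mem_Bm_of ?_ ?_, e, mem_Bp_of ?_ ?_, fixE_iff.2 ?_, fixE_iff.2 ?_, ?_⟩
    · intro i k hik
      simp only [c, Matrix.add_apply, Matrix.one_apply_ne hik.ne, Matrix.of_apply, zero_add]
      split_ifs with h
      · subst h; simp [a, hik.ne, hik.asymm]
      · rfl
    · intro i
      simp only [c, Matrix.add_apply, Matrix.one_apply_eq, Matrix.of_apply]
      split_ifs with h
      · subst h; simp [a, hj]
      · simp
    · intro k l hkl
      simp only [e, Matrix.add_apply, Matrix.one_apply_ne hkl.ne', Matrix.of_apply, zero_add]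
      split_ifs with h
      · subst h; simp [β, hkl.asymm]
      · rfl
    · intro k
      simp only [e, Matrix.add_apply, Matrix.one_apply_eq, Matrix.of_apply]
      split_ifs with h
      · subst h; simp [β]
      · simp
    · intro i k hik
      simp only [c, Matrix.add_apply, Matrix.of_apply, Matrix.one_apply]
      have : (if k = r then a i else 0) = 0 := by
        split_ifs with h
        · subst h
          have hi : i < k := Fin.lt_def.2 (by omega)
          simp [a, hi.ne, hi.asymm]
        · rfl
      rw [this, add_zero]
    · intro k l hkl
      simp only [e, Matrix.add_apply, Matrix.of_apply, Matrix.one_apply]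
      have : (if k = j then β l else 0) = 0 := by
        split_ifs with h
        · subst h
          have hi : l < k := Fin.lt_def.2 (by omega)
          simp [β, hi.asymm]
        · rfl
      rw [this, add_zero]
    · intro i hi
      rcases hi.eq_or_lt with rfl | hi
      · intro l hl
        rw [hyr] at hl
        have hlj : l = j := by by_contra h; simp [h] at hl
        subst hlj
        refine ⟨by rw [hyr]; simp, fun l' h => by rw [hyr]; simp [h], fun i' h => ?_⟩
        rcases lt_or_gt_of_ne h with h | h
        · rw [hylt _ _ h, hxj _ h]
        · rw [hygt _ _ h]; field_simp; ring
      · intro l hl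
        rw [hylt _ _ hi] at hl ⊢
        obtain ⟨h1, h2, h3⟩ := hg i hi l hl
        refine ⟨h1, fun l' h => by rw [hylt _ _ hi]; exact h2 l' h, fun i' h => ?_⟩
        have hxr := h3 r hi.ne'
        have hlj : l ≠ j := by rintro rfl; exact hj hxr
        rcases lt_trichotomy i' r with h' | h' | h'
        · rw [hylt _ _ h']; exact h3 i' h
        · subst h'; rw [hyr]; simp [hlj]
        · rw [hygt _ _ h', hxr, h3 i' h]; simp

lemma elim_ind {m n t : ℕ} (htm : t ≤ m) (htn : t ≤ n) {x : Mat m n} (h1 : x * Imn n n t = Imn m n t)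
    (h2 : Imn m m t * x = Imn m n t) (r : ℕ) (hr : r ≤ m) :
    ∃ c ∈ Bm m, ∃ e ∈ Bp n, fixE m t c ∧ fixE n t e ∧
      ∀ i : Fin m, (i:ℕ) < r → goodRow (c * x * e) i := by
  induction r with
  | zero => exact ⟨1, Bm_one _, 1, Bp_one _, fixE_one _ _, fixE_one _ _, fun i hi => absurd hi (by omega)⟩
  | succ r ih =>
    obtain ⟨c, hc, e, he, fc, fe, hg⟩ := ih (by omega)
    set x' := c * x * e with hx'
    have h1' : x' * Imn n n t = Imn m n t := by
      rw [hx', Matrix.mul_assoc, fe.1, Matrix.mul_assoc, h1]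
      have := fc.1
      calc c * Imn m n t = c * Imn m m t * Imn m n t := by rw [Matrix.mul_assoc, Imn_mul_Imn htm]
        _ = _ := by rw [fc.1, Imn_mul_Imn htm]
    have h2' : Imn m m t * x' = Imn m n t := by
      rw [hx', ← Matrix.mul_assoc, ← Matrix.mul_assoc, fc.2, h2]
      calc Imn m n t * e = Imn m n t * (Imn n n t * e) := by rw [← Matrix.mul_assoc, Imn_mul_Imn htn]
        _ = _ := by rw [fe.2, Imn_mul_Imn htn]
    have hxl : ∀ (i : Fin m) (j : Fin n), (j:ℕ) < t → x' i j = Imn m n t i j := by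
      intro i j hj
      have := congrFun (congrFun h1' i) j
      rwa [mul_Imn_apply, dif_pos ⟨hj, j.2⟩] at this
    have hxr : ∀ (i : Fin m) (j : Fin n), (i:ℕ) < t → x' i j = Imn m n t i j := by
      intro i j hj
      have := congrFun (congrFun h2' i) j
      rwa [Imn_mul_apply, dif_pos ⟨hj, i.2⟩] at this
    by_cases hrt : r < t
    · refine ⟨c, hc, e, he, fc, fe, ?_⟩
      intro i hi
      by_cases hir : (i:ℕ) < r
      · exact hg i hir
      · have hir : (i:ℕ) < t := by omega
        intro l hl
        change x' i l ≠ 0 at hl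
        change x' i l = 1 ∧ (∀ l', l' ≠ l → x' i l' = 0) ∧ ∀ i', i' ≠ i → x' i' l = 0
        rw [hxr i l hir] at hl ⊢
        have hil : (i:ℕ) = l := by by_contra h; simp [Imn, h] at hl
        refine ⟨by simp [Imn, hil]; omega, fun l' h => ?_, fun i' h => ?_⟩
        · rw [hxr i l' hir]; simp only [Imn]; rw [if_neg]; rintro ⟨h', -⟩
          exact h (Fin.ext (by omega))
        · rw [hxl i' l (by omega)]; simp only [Imn]; rw [if_neg]; rintro ⟨h', -⟩
          exact h (Fin.ext (by omega))
    · obtain ⟨c', hc', e', he', fc', fe', hg'⟩ := elim_step (t := t) (x := x')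
        (fun i j hj hi => by rw [hxl i j hj]; simp only [Imn]; rw [if_neg]; omega) ⟨r, by omega⟩ 
        (by simpa using hrt) (fun i hi => hg i hi)
      refine ⟨c' * c, Bm_mul hc' hc, e * e', Bp_mul he he', fixE_mul fc' fc, fixE_mul fe fe', ?_⟩
      intro i hi
      have : c' * c * x * (e * e') = c' * x' * e' := by rw [hx']; simp only [Matrix.mul_assoc]
      rw [this]
      exact hg' i (Fin.le_def.2 (by simp; omega))

lemma elim {m n t : ℕ} (htm : t ≤ m) (htn : t ≤ n) {x : Mat m n} (h1 : x * Imn n n t = Imn m n t)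
    (h2 : Imn m m t * x = Imn m n t) :
    ∃ c ∈ Bm m, ∃ e ∈ Bp n, fixE m t c ∧ fixE n t e ∧ ∀ i : Fin m, goodRow (c * x * e) i := by
  obtain ⟨c, hc, e, he, fc, fe, hg⟩ := elim_ind htm htn h1 h2 m le_rfl
  exact ⟨c, hc, e, he, fc, fe, fun i => hg i i.2⟩

lemma good_unit {k : ℕ} {s : Mat k k} (hs : IsUnit s) (hg : ∀ i, goodRow s i) :
    ∃ P, s = permMat k P := by
  have hne : ∀ j, ∃ i, s i j ≠ 0 := by
    intro j
    by_contra h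
    push Not at h
    have h1 := Matrix.det_eq_zero_of_column_eq_zero j h
    have h2 := (Matrix.isUnit_iff_isUnit_det _).1 hs
    rw [h1] at h2; simp at h2
  choose f hf using hne
  have hinj : Function.Injective f := by
    intro a b hab
    by_contra hne
    have := (hg (f b) b (hf b)).2.1 a hne
    rw [← hab] at this
    exact hf a this
  refine ⟨Equiv.ofBijective f (Finite.injective_iff_bijective.1 hinj), ?_⟩
  ext i j
  simp only [permMat, Equiv.ofBijective_apply]
  split_ifs with h
  · subst h; exact (hg _ _ (hf j)).1
  · exact (hg _ _ (hf j)).2.2 i h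

lemma sortedPerm {k t : ℕ} (S : Finset (Fin k)) (hS : S.card = t) :
    ∃ z : Equiv.Perm (Fin k), headMono t z ∧ tailMono t z ∧ ∀ i, z i ∈ S ↔ (i:ℕ) < t := by
  obtain ⟨l, hl⟩ : ∃ l, Sᶜ.card = l := ⟨_, rfl⟩
  have hk : t + l = k := by
    have := Finset.card_add_card_compl S
    rw [hS, hl, Fintype.card_fin] at this; exact this
  let f := finSumEquivOfFinset hS hl
  let z : Fin k ≃ Fin k := ((finCongr hk.symm).trans finSumFinEquiv.symm).trans f
  have hz1 : ∀ (i : Fin k) (hi : (i:ℕ) < t), z i = S.orderEmbOfFin hS ⟨i, hi⟩ := by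
    intro i hi
    have : finSumFinEquiv.symm (finCongr hk.symm i) = Sum.inl ⟨i, hi⟩ := by
      rw [Equiv.symm_apply_eq]; ext; simp
    change f (finSumFinEquiv.symm (finCongr hk.symm i)) = _
    rw [this]; simp [f]
  have hz2 : ∀ (i : Fin k) (hi : t ≤ (i:ℕ)), z i = Sᶜ.orderEmbOfFin hl ⟨i - t, by omega⟩ := by
    intro i hi
    have : finSumFinEquiv.symm (finCongr hk.symm i) = Sum.inr ⟨i - t, by omega⟩ := by
      rw [Equiv.symm_apply_eq]; ext; simp; omega
    change f (finSumFinEquiv.symm (finCongr hk.symm i)) = _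
    rw [this]; simp [f]
  refine ⟨z, ?_, ?_, ?_⟩
  · intro i j hij hj
    rw [hz1 i (by omega), hz1 j hj]
    simpa using hij
  · intro i j hij hj
    rw [hz2 i hj, hz2 j (by omega)]
    simp; omega
  · intro i
    by_cases hi : (i:ℕ) < t
    · rw [hz1 i hi]; simp [hi]
    · rw [hz2 i (by omega)]
      have := Finset.orderEmbOfFin_mem Sᶜ hl ⟨i - t, by omega⟩
      rw [Finset.mem_compl] at this
      tauto


lemma perm_ai {k : ℕ} (p : Equiv.Perm (Fin k)) (x : Fin k) : p (p⁻¹ x) = x := Equiv.apply_symm_apply p x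
lemma perm_ia {k : ℕ} (p : Equiv.Perm (Fin k)) (x : Fin k) : p⁻¹ (p x) = x := Equiv.symm_apply_apply p x

lemma good_rect {m n : ℕ} (hm : 0 < m) {s : Mat m n} (hg : ∀ i, goodRow s i) :
    ∃ (t : ℕ) (htm : t ≤ m) (htn : t ≤ n) (z0 : Equiv.Perm (Fin m)) (v0 : Equiv.Perm (Fin n))
      (τ : Equiv.Perm (Fin t)),
      headMono t z0 ∧ tailMono t z0 ∧ headMono t v0 ∧ tailMono t v0 ∧
      s = permMat m z0 * permMat m (embPerm htm τ) * Imn m n t * permMat n v0⁻¹ := by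
  classical
  let C : Finset (Fin n) := Finset.univ.filter (fun j => ∃ a, s a j ≠ 0)
  have hC : ∀ j, ∃ a : Fin m, j ∈ C → s a j ≠ 0 := by
    intro j
    by_cases h : ∃ a, s a j ≠ 0
    · obtain ⟨a, ha⟩ := h; exact ⟨a, fun _ => ha⟩
    · exact ⟨⟨0, hm⟩, fun h' => absurd (by simpa [C] using h') h⟩
  choose r hr using hC
  have hs : ∀ a b, s a b = if b ∈ C ∧ a = r b then 1 else 0 := by
    intro a b
    split_ifs with h
    · rw [h.2]; exact (hg _ _ (hr b h.1)).1
    · by_cases hb : b ∈ C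
      · exact (hg _ _ (hr b hb)).2.2 a (fun h' => h ⟨hb, h'⟩)
      · by_contra h'
        exact hb (by simp only [C, Finset.mem_filter, Finset.mem_univ, true_and]; exact ⟨a, h'⟩)
  have hinj : ∀ a ∈ C, ∀ b ∈ C, r a = r b → a = b := by
    intro a ha b hb hab
    by_contra hne
    have := (hg _ _ (hr b hb)).2.1 a hne
    rw [← hab] at this
    exact hr a ha this
  obtain ⟨t, ht⟩ : ∃ t, C.card = t := ⟨_, rfl⟩
  have hR : (C.image r).card = t := by
    rw [Finset.card_image_of_injOn]
    · exact ht
    · intro a ha b hb; exact hinj a ha b hb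
  have htn : t ≤ n := by rw [← ht]; simpa using Finset.card_le_univ C
  have htm : t ≤ m := by rw [← hR]; simpa using Finset.card_le_univ (C.image r)
  obtain ⟨z0, hz1, hz2, hz3⟩ := sortedPerm _ hR
  obtain ⟨v0, hv1, hv2, hv3⟩ := sortedPerm _ ht
  have hmem : ∀ j : Fin n, (j:ℕ) < t → ((z0⁻¹ (r (v0 j)) : Fin m) : ℕ) < t := by
    intro j hj
    rw [← hz3, perm_ai]
    exact Finset.mem_image_of_mem _ ((hv3 _).2 hj)
  let f : Fin t → Fin t := fun i => ⟨z0⁻¹ (r (v0 (Fin.castLE htn i))), hmem _ i.2⟩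
  have hf : Function.Injective f := by
    intro i j hij
    have h1 : z0⁻¹ (r (v0 (Fin.castLE htn i))) = z0⁻¹ (r (v0 (Fin.castLE htn j))) := by
      apply Fin.ext
      simpa only [f, Fin.mk.injEq] using hij
    have h2 := z0⁻¹.injective h1
    have h3 := v0.injective (hinj _ ((hv3 _).2 i.2) _ ((hv3 _).2 j.2) h2)
    simpa [Fin.ext_iff] using h3
  refine ⟨t, htm, htn, z0, v0, Equiv.ofBijective f (Finite.injective_iff_bijective.1 hf),
    hz1, hz2, hv1, hv2, ?_⟩
  ext a b
  obtain ⟨a, rfl⟩ := z0.surjective a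
  obtain ⟨b, rfl⟩ := v0.surjective b
  rw [mul_permMat_apply, Matrix.mul_assoc, permMat_mul_apply, perm_ia,
    perm_ia, mul_Imn_apply, hs]
  simp only [hv3]
  by_cases hb : (b:ℕ) < t
  · rw [dif_pos ⟨hb, by omega⟩]
    simp only [permMat]
    rw [embPerm_lt htm _ ⟨(b:ℕ), by omega⟩ hb]
    have : Fin.castLE htm (Equiv.ofBijective f (Finite.injective_iff_bijective.1 hf) ⟨b, hb⟩) =
        z0⁻¹ (r (v0 b)) := rfl
    rw [this]
    have : z0 a = r (v0 b) ↔ a = z0⁻¹ (r (v0 b)) := by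
      rw [Equiv.Perm.eq_inv_iff_eq]
    simp [hb, this]
  · rw [dif_neg (by tauto), if_neg (by tauto)]

lemma tail_factor {k t : ℕ} (htk : t ≤ k) (y0 : Equiv.Perm (Fin k)) :
    ∃ y s : Equiv.Perm (Fin k), tailMono t y ∧ y0 = y * s ∧ ∀ i : Fin k, (i:ℕ) < t → s i = i := by
  classical
  let S : Finset (Fin k) := (Finset.univ.filter (fun i : Fin k => (i:ℕ) < t)).image y0
  have hS : S.card = t := by
    rw [Finset.card_image_of_injective _ y0.injective, Fin.card_filter_val_lt]
    omega
  obtain ⟨z, hz1, hz2, hz3⟩ := sortedPerm S hS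
  have hS' : ∀ i : Fin k, (i:ℕ) < t → y0 i ∈ S := fun i hi =>
    Finset.mem_image_of_mem _ (by simpa using hi)
  let f : Fin k → Fin k := fun i => if (i:ℕ) < t then y0 i else z i
  have hf : Function.Injective f := by
    intro i j hij
    simp only [f] at hij
    split_ifs at hij with h1 h2 h2
    · exact y0.injective hij
    · exact absurd ((hz3 j).1 (hij ▸ hS' i h1)) h2
    · exact absurd ((hz3 i).1 (hij ▸ hS' j h2)) h1
    · exact z.injective hij
  let y : Equiv.Perm (Fin k) := Equiv.ofBijective f (Finite.injective_iff_bijective.1 hf)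
  have hy : ∀ i, y i = if (i:ℕ) < t then y0 i else z i := fun i => rfl
  refine ⟨y, y⁻¹ * y0, ?_, by simp, ?_⟩
  · intro i j hij hi
    rw [hy, hy, if_neg (by omega), if_neg (by omega)]
    exact hz2 i j hij hi
  · intro i hi
    have : y0 i = y i := by rw [hy, if_pos hi]
    rw [Equiv.Perm.mul_apply, this, perm_ia]

lemma bruhat_exists {k : ℕ} {g : Mat k k} (hg : IsUnit g) :
    ∃ b ∈ Bp k, ∃ b' ∈ Bp k, ∃ y, g = b * permMat k y * b' := by
  have hI : ∀ a b, Imn a b 0 = 0 := by intro a b; ext i j; simp [Imn]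
  obtain ⟨c, hc, e, he, -, -, h⟩ := elim (t := 0) (Nat.zero_le k) (Nat.zero_le k)
    (x := permMat k (revP k) * g) (by simp [hI]) (by simp [hI])
  obtain ⟨P, hP⟩ := good_unit ((hc.1.mul ((permMat_isUnit k _).mul hg)).mul he.1) h
  refine ⟨_, Bm_rev (Bm_inv hc), _, Bp_inv he, revP k * P, ?_⟩
  rw [permMat_mul, ← hP]
  have e1 : permMat k (revP k) * c⁻¹ * permMat k (revP k) *
      (permMat k (revP k) * (c * (permMat k (revP k) * g) * e)) * e⁻¹ =
      permMat k (revP k) * (c⁻¹ * ((permMat k (revP k) * permMat k (revP k)) * c)) * permMat k (revP k)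
       * g * (e * e⁻¹) := by simp only [Matrix.mul_assoc]
  rw [e1, rev_mul_rev, Matrix.one_mul, (unit_inv hc.1).2, (unit_inv he.1).1, Matrix.mul_one,
    Matrix.mul_one, rev_mul_rev, Matrix.one_mul]

lemma fixE_comm {k t : ℕ} (htk : t ≤ k) (τ : Equiv.Perm (Fin t)) {F : Mat k k} (hF : fixE k t F) :
    permMat k (embPerm htk τ) * F = F * permMat k (embPerm htk τ) := by
  set T := permMat k (embPerm htk τ)
  have h1 : T * Jk k t = Jk k t := embPerm_J htk τ
  have h2 : Jk k t * T = Jk k t := J_embPerm htk τ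
  have h3 : T * Imn k k t = Imn k k t * T := embPerm_comm htk htk τ
  have h4 : (1 : Mat k k) = Imn k k t + Jk k t := by rw [Jk_eq]; abel
  calc T * F = T * (1 * F) := by rw [Matrix.one_mul]
    _ = (T * Imn k k t) + Jk k t * F := by
      rw [h4, Matrix.add_mul, Matrix.mul_add, hF.2, ← Matrix.mul_assoc, h1]
    _ = Imn k k t * T + F * Jk k t := by
      rw [h3, Jk_eq, Matrix.sub_mul, Matrix.mul_sub, hF.1, hF.2, Matrix.one_mul, Matrix.mul_one]
    _ = F * 1 * T := by
      rw [h4, Matrix.mul_add, hF.1, Matrix.add_mul, Matrix.mul_assoc F, h2]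
    _ = F * T := by rw [Matrix.mul_one]

lemma fixE_EJ {k t : ℕ} {F : Mat k k} (hF : fixE k t F) :
    Imn k k t + Jk k t * F * Jk k t = F := by
  ext i j
  rw [EJ_apply]
  split_ifs with h1 h2
  · rfl
  · rw [fixE_iff.1 hF i j (by omega), if_pos h2]
  · rw [fixE_iff.1 hF i j (by omega), if_neg h2]

lemma lemL {k t : ℕ} (htk : t ≤ k) {c : Mat k k} (hc : c ∈ Bm k) {z0 : Equiv.Perm (Fin k)}
    (hz0 : tailMono t z0) (τ : Equiv.Perm (Fin t)) :
    ∃ (y z : Equiv.Perm (Fin k)) (g : Mat k k), tailMono t y ∧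
      (∀ i : Fin k, (i:ℕ) < t → z i = z0 i) ∧
      g ∈ dcPlus (permMat k y) ∧ (∃ β ∈ Bm k, g = β * permMat k (z * embPerm htk τ)) ∧
      g * Imn k k t = c * permMat k z0 * permMat k (embPerm htk τ) * Imn k k t := by
  set T := permMat k (embPerm htk τ) with hT
  obtain ⟨b, hb, b', hb', y0, hg0⟩ := bruhat_exists
    (g := c * permMat k z0 * T) ((hc.1.mul (permMat_isUnit _ _)).mul (permMat_isUnit _ _))
  obtain ⟨y, s, hy, rfl, hs⟩ := tail_factor htk y0
  have hs' : ∀ i : Fin k, (i:ℕ) < t → s⁻¹ i = i := by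
    intro i hi
    conv_lhs => rw [← hs i hi]
    exact perm_ia s i
  have hs'' : ∀ i : Fin k, t ≤ (i:ℕ) → t ≤ ((s⁻¹ i : Fin k) : ℕ) := by
    intro i hi
    by_contra h
    have := hs (s⁻¹ i) (by omega)
    rw [perm_ai] at this
    rw [← this] at h
    omega
  set M := permMat k s * b' with hM
  have hMu : IsUnit M := (permMat_isUnit _ _).mul hb'.1
  have hM1 : ∀ i j : Fin k, (i:ℕ) < t → M i j = b' i j := by
    intro i j hi
    rw [hM, permMat_mul_apply, hs' i hi]
  have hM2 : ∀ i j : Fin k, t ≤ (i:ℕ) → (j:ℕ) < t → M i j = 0 := by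
    intro i j hi hj
    rw [hM, permMat_mul_apply]
    exact hb'.2 _ _ (by have := hs'' i hi; rw [Fin.lt_def]; omega)
  have hJM : Jk k t * M * Jk k t = Jk k t * M := by
    ext i j
    rw [mul_Jk_apply, Jk_mul_apply]
    split_ifs with h1 h2 h2
    · rfl
    · rfl
    · exact (hM2 i j h2 (by omega)).symm
    · rfl
  set N := Imn k k t + Jk k t * M⁻¹ * Jk k t with hN
  have hEJ : Imn k k t + Jk k t = 1 := by rw [Jk_eq]; abel
  have hJJ : Jk k t * Jk k t = Jk k t := JJ htk
  have hEE : Imn k k t * Imn k k t = Imn k k t := Imn_mul_Imn htk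
  have hJE : Jk k t * Imn k k t = 0 := JI htk
  have hEJ0 : Imn k k t * Jk k t = 0 := IJ htk
  have hJMJN : Jk k t * M * Jk k t * M⁻¹ * Jk k t = Jk k t := by
    rw [hJM, Matrix.mul_assoc (Jk k t), (unit_inv hMu).1, Matrix.mul_one, hJJ]
  have hNu1 : (Imn k k t + Jk k t * M * Jk k t) * N = 1 := by
    rw [hN]
    have : (Imn k k t + Jk k t * M * Jk k t) * (Imn k k t + Jk k t * M⁻¹ * Jk k t) =
      Imn k k t * Imn k k t + (Imn k k t * Jk k t) * M⁻¹ * Jk k t + Jk k t * M * (Jk k t * Imn k k t)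
      + Jk k t * M * (Jk k t * Jk k t) * M⁻¹ * Jk k t := by noncomm_ring
    rw [this, hEE, hEJ0, hJE, hJJ, hJMJN, Matrix.zero_mul, Matrix.zero_mul, Matrix.mul_zero, add_zero,
      add_zero, hEJ]
  have hNu : IsUnit N := IsUnit.of_mul_eq_one_right _ hNu1
  have hNf : fixE k t N := by
    rw [fixE_iff]
    intro i j hij
    rw [hN, EJ_apply, if_neg (by omega)]
  have hJMN : Jk k t * (M * N) = Jk k t := by
    rw [← Matrix.mul_assoc, ← hJM, hN]
    have : Jk k t * M * Jk k t * (Imn k k t + Jk k t * M⁻¹ * Jk k t) =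
      Jk k t * M * (Jk k t * Imn k k t) + Jk k t * M * (Jk k t * Jk k t) * M⁻¹ * Jk k t := by
      noncomm_ring
    rw [this, hJE, hJJ, hJMJN, Matrix.mul_zero, zero_add]
  have hMNB : M * N ∈ Bp k := by
    refine ⟨hMu.mul hNu, fun i j hij => ?_⟩
    by_cases hi : t ≤ (i:ℕ)
    · have := congrFun (congrFun hJMN i) j
      rw [Jk_mul_apply, if_pos hi] at this
      rw [this]
      simp only [Jk]
      rw [if_neg]
      rw [Fin.lt_def] at hij
      omega
    · have h1 : M * N * Imn k k t = M * Imn k k t := by rw [Matrix.mul_assoc, hNf.1]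
      have := congrFun (congrFun h1 i) j
      rw [Fin.lt_def] at hij
      rw [mul_Imn_apply, mul_Imn_apply, dif_pos ⟨by omega, by omega⟩, dif_pos ⟨by omega, by omega⟩] at this
      rw [show (M * N) i j = _ from this, show M i ⟨j, _⟩ = b' i j from hM1 i j (by omega)]
      exact hb'.2 i j hij
  obtain ⟨c2, hc2, e2, he2, fc2, fe2, h⟩ := elim htk htk hNf.1 hNf.2
  obtain ⟨P, hP⟩ := good_unit ((hc2.1.mul hNu).mul he2.1) h
  have fP : fixE k t (permMat k P) := by rw [← hP]; exact fixE_mul (fixE_mul fc2 hNf) fe2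
  have hPi : ∀ i : Fin k, (i:ℕ) < t → P i = i := by
    intro i hi
    have := fixE_iff.1 fP (P i) i (Or.inr hi)
    simp only [permMat, if_true] at this
    by_contra h
    rw [if_neg h] at this
    exact one_ne_zero this
  have hQ : N * e2 = c2⁻¹ * permMat k P := by
    rw [← hP, ← Matrix.mul_assoc, ← Matrix.mul_assoc, (unit_inv hc2.1).2, Matrix.one_mul]
  have fQ : fixE k t (N * e2) := fixE_mul hNf fe2
  refine ⟨y, z0 * P, c * permMat k z0 * T * (N * e2), hy, ?_, ?_, ?_, ?_⟩
  · intro i hi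
    rw [Equiv.Perm.mul_apply, hPi i hi]
  · refine ⟨b, hb, M * N * e2, Bp_mul hMNB he2, ?_⟩
    rw [hg0, permMat_mul, hM]
    simp only [Matrix.mul_assoc]
  · refine ⟨c * (permMat k z0 * c2⁻¹ * permMat k z0⁻¹), Bm_mul hc ⟨?_, ?_⟩, ?_⟩
    · exact ((permMat_isUnit _ _).mul (Bm_inv hc2).1).mul (permMat_isUnit _ _)
    · have := tail_conj_lower hz0 (Bm_inv hc2).2
      rwa [fixE_EJ (fixE_inv hc2.1 fc2)] at this
    · rw [Matrix.mul_assoc, fixE_comm htk τ fQ, hQ, permMat_mul, permMat_mul]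
      simp only [Matrix.mul_assoc]
      rw [permMat_inv_mul']
  · rw [Matrix.mul_assoc _ (N * e2), fQ.1]

lemma exists_decomp {m n : ℕ} (hm : 0 < m) (x : Mat m n) :
    ∃ (t : ℕ) (htm : t ≤ m) (htn : t ≤ n) (y : Equiv.Perm (Fin m)) (v : Equiv.Perm (Fin n))
      (z : Equiv.Perm (Fin m)) (u : Equiv.Perm (Fin n)),
      tailMono t y ∧ headMono t v ∧ headMono t z ∧ tailMono t u ∧ x ∈ Pt m n t htm htn y v z u := by
  have hI : ∀ a b, Imn a b 0 = 0 := by intro a b; ext i j; simp [Imn]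
  obtain ⟨c, hc, e, he, -, -, h⟩ := elim (t := 0) (Nat.zero_le m) (Nat.zero_le n)
    (x := x) (by simp [hI]) (by simp [hI])
  obtain ⟨t, htm, htn, z0, v0, τ, hz1, hz2, hv1, hv2, hs⟩ := good_rect hm h
  have hx : x = c⁻¹ * (c * x * e) * e⁻¹ := by
    have : c⁻¹ * (c * x * e) * e⁻¹ = (c⁻¹ * c) * x * (e * e⁻¹) := by simp only [Matrix.mul_assoc]
    rw [this, (unit_inv hc.1).2, (unit_inv he.1).1, Matrix.one_mul, Matrix.mul_one]
  rw [hs] at hx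
  obtain ⟨y, z, g, hy, hz, hg1, hg2, hg3⟩ := lemL htm (Bm_inv hc) hz2 τ
  obtain ⟨u, v, g', hu, hv, hg1', hg2', hg3'⟩ := lemL htn (Bp_transpose (Bp_inv he)) hv2 τ⁻¹
  have hzh : headMono t z := by
    intro i j hij hj
    rw [hz i (by rw [Fin.lt_def] at hij; omega), hz j hj]
    exact hz1 i j hij hj
  have hvh : headMono t v := by
    intro i j hij hj
    rw [hv i (by rw [Fin.lt_def] at hij; omega), hv j hj]
    exact hv1 i j hij hj
  refine ⟨t, htm, htn, y, v, z, u, hy, hvh, hzh, hu, τ, bruhat_of_inter hg1 hg2, ?_, g, ⟨hg1, hg2⟩,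
    permMat n (embPerm htn τ)⁻¹ * g'ᵀ, ⟨⟨g'ᵀ, ?_, rfl⟩, ?_⟩, ?_⟩
  · rw [embPerm_inv]; exact bruhat_of_inter hg1' hg2'
  · obtain ⟨b, hb, b', hb', rfl⟩ := hg1'
    refine ⟨_, Bp_transpose hb', _, Bp_transpose hb, ?_⟩
    rw [Matrix.transpose_mul, Matrix.transpose_mul, permMat_transpose, Matrix.mul_assoc]
  · obtain ⟨β, hβ, rfl⟩ := hg2'
    refine ⟨_, Bm_transpose hβ, ?_⟩
    rw [Matrix.transpose_mul, permMat_transpose, ← Matrix.mul_assoc, ← permMat_mul, _root_.mul_inv_rev,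
      embPerm_inv, embPerm_inv, ← mul_assoc, inv_inv, ← embPerm_inv, inv_mul_cancel, one_mul]
  · have h1 : g * Imn m n t = c⁻¹ * permMat m z0 * permMat m (embPerm htm τ) * Imn m n t := by
      have := congrArg (· * Imn m n t) hg3
      simpa only [Matrix.mul_assoc, Imn_mul_Imn htm] using this
    have h2 : Imn n n t * g'ᵀ = Imn n n t * permMat n (embPerm htn τ) * permMat n v0⁻¹ * e⁻¹ := by
      have := congrArg Matrix.transpose hg3'
      simp only [Matrix.transpose_mul, Matrix.transpose_transpose, permMat_transpose, Imn_transpose] at this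
      rw [this, ← embPerm_inv, inv_inv]
      simp only [Matrix.mul_assoc]
    have h3 : Imn m n t * (permMat n (embPerm htn τ)⁻¹ * g'ᵀ) = Imn m n t * permMat n v0⁻¹ * e⁻¹ := by
      rw [embPerm_inv, ← Matrix.mul_assoc, ← embPerm_comm htm, Matrix.mul_assoc,
        ← Imn_mul_Imn (m := m) (l := n) htn, Matrix.mul_assoc (Imn m n t), h2]
      have : permMat m (embPerm htm τ⁻¹) * (Imn m n t *
          (Imn n n t * permMat n (embPerm htn τ) * permMat n v0⁻¹ * e⁻¹)) =
          permMat m (embPerm htm τ⁻¹) * (Imn m n t * Imn n n t * permMat n (embPerm htn τ)) *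
            permMat n v0⁻¹ * e⁻¹ := by simp only [Matrix.mul_assoc]
      rw [this, Imn_mul_Imn htn, ← embPerm_comm htm htn, ← embPerm_inv, permMat_inv_mul']
    have h4 : g * (Imn m n t * permMat n v0⁻¹ * e⁻¹) = (g * Imn m n t) * permMat n v0⁻¹ * e⁻¹ := by
      simp only [Matrix.mul_assoc]
    rw [Matrix.mul_assoc, h3, h4, h1, hx]
    simp only [Matrix.mul_assoc]


lemma rb_apply {m n : ℕ} (A : Mat n n) (B : Mat n m) (C : Mat m n) (D : Mat m m) (i j) :
    rb m n A B C D (fe m n i) (fe m n j) = Matrix.fromBlocks A B C D i j := by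
  simp [rb]

lemma permMat3_apply {k l : ℕ} (a : Equiv.Perm (Fin k)) (b : Equiv.Perm (Fin l)) (M : Mat k l) (i j) :
    (permMat k a * M * permMat l b⁻¹) (a i) (b j) = M i j := by
  rw [mul_permMat_apply, permMat_mul_apply, perm_ia, perm_ia]

section wB
variable {m n t : ℕ} (y : Equiv.Perm (Fin m)) (v : Equiv.Perm (Fin n))
    (z : Equiv.Perm (Fin m)) (u : Equiv.Perm (Fin n))

lemma wB11 (k i) : wBlock m n t y v z u (fe m n (Sum.inl (revP n (u k)))) (fe m n (Sum.inl (v i))) = Jk n t k i := by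
  change rb m n _ _ _ _ _ _ = _
  rw [rb_apply, Matrix.fromBlocks_apply₁₁, ← permMat_mul]
  exact permMat3_apply (revP n * u) v _ k i

lemma wB12 (k i) : wBlock m n t y v z u (fe m n (Sum.inl (revP n (u k)))) (fe m n (Sum.inr (revP m (z i)))) =
    Imn n m t k i := by
  change rb m n _ _ _ _ _ _ = _
  rw [rb_apply, Matrix.fromBlocks_apply₁₂, ← permMat_mul, Matrix.mul_assoc _ (permMat m z⁻¹), ← permMat_mul]
  exact permMat3_apply (revP n * u) (revP m * z) _ k i

lemma wB21 (k i) : wBlock m n t y v z u (fe m n (Sum.inr (y k))) (fe m n (Sum.inl (v i))) = Imn m n t k i := by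
  change rb m n _ _ _ _ _ _ = _
  rw [rb_apply, Matrix.fromBlocks_apply₂₁]
  exact permMat3_apply y v _ k i

lemma wB22 (k i) : wBlock m n t y v z u (fe m n (Sum.inr (y k))) (fe m n (Sum.inr (revP m (z i)))) =
    Jk m t k i := by
  change rb m n _ _ _ _ _ _ = _
  rw [rb_apply, Matrix.fromBlocks_apply₂₂, Matrix.mul_assoc _ (permMat m z⁻¹), ← permMat_mul]
  exact permMat3_apply y (revP m * z) _ k i
end wB

structure WD {m n : ℕ} (t : ℕ) (htm : t ≤ m) (htn : t ≤ n) (y : Equiv.Perm (Fin m)) (v : Equiv.Perm (Fin n))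
    (z : Equiv.Perm (Fin m)) (u : Equiv.Perm (Fin n)) (w : Equiv.Perm (Fin (m+n))) : Prop where
  a : ∀ (i : Fin n) (hi : (i:ℕ) < t), w (fe m n (Sum.inl (v i))) = fe m n (Sum.inr (y ⟨i, hi.trans_le htm⟩))
  b : ∀ (i : Fin n), t ≤ (i:ℕ) → w (fe m n (Sum.inl (v i))) = fe m n (Sum.inl (revP n (u i)))
  c : ∀ (i : Fin m) (hi : (i:ℕ) < t), w (fe m n (Sum.inr (revP m (z i)))) =
    fe m n (Sum.inl (revP n (u ⟨i, hi.trans_le htn⟩)))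
  d : ∀ (i : Fin m), t ≤ (i:ℕ) → w (fe m n (Sum.inr (revP m (z i)))) = fe m n (Sum.inr (y i))

lemma permMat_eq_one {k : ℕ} {w : Equiv.Perm (Fin k)} {a b : Fin k} (h : permMat k w a b = 1) : w b = a := by
  simp only [permMat] at h
  by_contra h'
  rw [if_neg (Ne.symm h')] at h
  exact zero_ne_one h

lemma wdesc {m n t : ℕ} (htm : t ≤ m) (htn : t ≤ n) {y : Equiv.Perm (Fin m)} {v : Equiv.Perm (Fin n)}
    {z : Equiv.Perm (Fin m)} {u : Equiv.Perm (Fin n)} {w : Equiv.Perm (Fin (m+n))}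
    (hw : permMat (m+n) w = wBlock m n t y v z u) : WD t htm htn y v z u w := by
  constructor
  · intro i hi
    apply permMat_eq_one
    rw [hw, wB21]; simp [Imn, hi]
  · intro i hi
    apply permMat_eq_one
    rw [hw, wB11]; simp [Jk, hi]
  · intro i hi
    apply permMat_eq_one
    rw [hw, wB12]; simp [Imn, hi]
  · intro i hi
    apply permMat_eq_one
    rw [hw, wB22]; simp [Jk, hi]

def kap {m n t : ℕ} (htm : t ≤ m) (htn : t ≤ n) : Fin n ⊕ Fin m → Fin n ⊕ Fin m
  | Sum.inl i => if h : (i:ℕ) < t then Sum.inr ⟨i, h.trans_le htm⟩ else Sum.inl i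
  | Sum.inr i => if h : (i:ℕ) < t then Sum.inl ⟨i, h.trans_le htn⟩ else Sum.inr i

lemma kap_inv {m n t : ℕ} (htm : t ≤ m) (htn : t ≤ n) : Function.Involutive (kap htm htn) := by
  rintro (i | i)
  · by_cases h : (i:ℕ) < t <;> simp [kap, h]
  · by_cases h : (i:ℕ) < t <;> simp [kap, h]

lemma exists_w {m n t : ℕ} (htm : t ≤ m) (htn : t ≤ n) (y : Equiv.Perm (Fin m)) (v : Equiv.Perm (Fin n))
    (z : Equiv.Perm (Fin m)) (u : Equiv.Perm (Fin n)) :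
    ∃ w, permMat (m+n) w = wBlock m n t y v z u := by
  let κ : Fin n ⊕ Fin m ≃ Fin n ⊕ Fin m := (kap_inv htm htn).toPerm _
  let L : Fin n ⊕ Fin m ≃ Fin n ⊕ Fin m := Equiv.sumCongr (u.trans (revP n)) y
  let R : Fin n ⊕ Fin m ≃ Fin n ⊕ Fin m := Equiv.sumCongr v (z.trans (revP m))
  let w : Equiv.Perm (Fin (m+n)) := (fe m n).symm.trans (R.symm.trans (κ.trans (L.trans (fe m n))))
  have hw : ∀ b, w (fe m n (R b)) = fe m n (L (kap htm htn b)) := by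
    intro b; simp [w, κ]
  refine ⟨w, ?_⟩
  ext a b
  obtain ⟨a, rfl⟩ := (fe m n).surjective a
  obtain ⟨a, rfl⟩ := L.surjective a
  obtain ⟨b, rfl⟩ := (fe m n).surjective b
  obtain ⟨b, rfl⟩ := R.surjective b
  have : permMat (m+n) w (fe m n (L a)) (fe m n (R b)) = if a = kap htm htn b then 1 else 0 := by
    simp only [permMat, hw, EmbeddingLike.apply_eq_iff_eq]
  rw [this]
  rcases a with a | a <;> rcases b with b | b
  · refine Eq.trans ?_ (wB11 y v z u a b).symm
    by_cases h : (b:ℕ) < t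
    · simp [kap, h, Jk]; omega
    · by_cases h' : a = b
      · subst h'; simp [kap, h, Jk]
      · simp [kap, h, h', Jk]; intro h; exact absurd (Fin.ext h) h'
  · refine Eq.trans ?_ (wB12 y v z u a b).symm
    by_cases h : (b:ℕ) < t
    · simp only [kap, h, Imn, dif_pos, Sum.inl.injEq, Fin.ext_iff]
      congr 1; apply propext; constructor
      · intro h; exact ⟨h, by omega⟩
      · intro h; exact h.1
    · simp only [kap, h, Imn, dif_neg, not_false_eq_true]
      rw [if_neg (by simp), if_neg (by omega)]
  · refine Eq.trans ?_ (wB21 y v z u a b).symm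
    by_cases h : (b:ℕ) < t
    · simp only [kap, h, Imn, dif_pos, Sum.inr.injEq, Fin.ext_iff]
      congr 1; apply propext; constructor
      · intro h; exact ⟨h, by omega⟩
      · intro h; exact h.1
    · simp only [kap, h, Imn, dif_neg, not_false_eq_true]
      rw [if_neg (by simp), if_neg (by omega)]
  · refine Eq.trans ?_ (wB22 y v z u a b).symm
    by_cases h : (b:ℕ) < t
    · simp [kap, h, Jk]; omega
    · by_cases h' : a = b
      · subst h'; simp [kap, h, Jk]
      · simp [kap, h, h', Jk]; intro h; exact absurd (Fin.ext h) h'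

lemma mono_eq {k : ℕ} (p : Fin k → Prop) {a b : Equiv.Perm (Fin k)}
    (ha : ∀ i j, i < j → p i → p j → a i < a j) (hb : ∀ i j, i < j → p i → p j → b i < b j)
    (h : ∀ x, p (a⁻¹ x) ↔ p (b⁻¹ x)) (i : Fin k) (hi : p i) : a i = b i := by
  have h1 : StrictMono (fun i : {i // p i} => a i.1) := fun i j hij => ha _ _ hij i.2 j.2
  have h2 : StrictMono (fun i : {i // p i} => b i.1) := fun i j hij => hb _ _ hij i.2 j.2
  have h3 : Set.range (fun i : {i // p i} => a i.1) = Set.range (fun i : {i // p i} => b i.1) := by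
    ext x
    constructor
    · rintro ⟨i, rfl⟩
      exact ⟨⟨b⁻¹ (a i.1), by rw [← h, perm_ia]; exact i.2⟩, perm_ai _ _⟩
    · rintro ⟨i, rfl⟩
      exact ⟨⟨a⁻¹ (b i.1), by rw [h, perm_ia]; exact i.2⟩, perm_ai _ _⟩
  exact congrFun ((StrictMono.range_inj h1 h2).1 h3) ⟨i, hi⟩

lemma mono_eq' {k : ℕ} (p : Fin k → Prop) {a b : Equiv.Perm (Fin k)}
    (ha : ∀ i j, i < j → p i → p j → a i < a j) (hb : ∀ i j, i < j → p i → p j → b i < b j)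
    (h : ∀ i, ¬ p i → a i = b i) : a = b := by
  have h' : ∀ x, p (a⁻¹ x) ↔ p (b⁻¹ x) := by
    intro x
    by_cases h1 : p (a⁻¹ x) <;> by_cases h2 : p (b⁻¹ x)
    · tauto
    · have := h _ h2
      rw [perm_ai, ← perm_ai a x] at this
      have := a.injective this
      rw [perm_ai] at this
      rw [this] at h2; tauto
    · have := h _ h1
      rw [perm_ai] at this
      nth_rw 1 [← perm_ai b x] at this
      have := b.injective this
      rw [← this] at h1; tauto
    · tauto
  ext i
  by_cases hi : p i
  · rw [mono_eq p ha hb h' i hi]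
  · rw [h i hi]

lemma wd_inl {m n t : ℕ} {htm : t ≤ m} {htn : t ≤ n} {y : Equiv.Perm (Fin m)} {v : Equiv.Perm (Fin n)}
    {z : Equiv.Perm (Fin m)} {u : Equiv.Perm (Fin n)} {w : Equiv.Perm (Fin (m+n))}
    (h : WD t htm htn y v z u w) (x : Fin n) :
    ((v⁻¹ x : Fin n) : ℕ) < t ↔ ∃ a, w (fe m n (Sum.inl x)) = fe m n (Sum.inr a) := by
  obtain ⟨i, rfl⟩ := v.surjective x
  rw [perm_ia]
  constructor
  · intro hi; exact ⟨_, h.a i hi⟩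
  · rintro ⟨a, ha⟩
    by_contra hi
    rw [h.b i (by omega)] at ha
    have := (fe m n).injective ha
    simp at this

lemma wd_inj {m n t t' : ℕ} {htm : t ≤ m} {htn : t ≤ n} {htm' : t' ≤ m} {htn' : t' ≤ n}
    {y y' : Equiv.Perm (Fin m)} {v v' : Equiv.Perm (Fin n)}
    {z z' : Equiv.Perm (Fin m)} {u u' : Equiv.Perm (Fin n)} {w : Equiv.Perm (Fin (m+n))}
    (h : WD t htm htn y v z u w) (h' : WD t' htm' htn' y' v' z' u' w)
    (hy : tailMono t y) (hv : headMono t v) (hz : headMono t z) (hu : tailMono t u)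
    (hy' : tailMono t' y') (hv' : headMono t' v') (hz' : headMono t' z') (hu' : tailMono t' u') :
    t = t' ∧ y = y' ∧ v = v' ∧ z = z' ∧ u = u' := by
  classical
  have hset : ∀ x, ((v⁻¹ x : Fin n) : ℕ) < t ↔ ((v'⁻¹ x : Fin n) : ℕ) < t' := fun x => by
    rw [wd_inl h, wd_inl h']
  have htt : t = t' := by
    have key : ∀ (s : ℕ) (hs : s ≤ n) (p : Equiv.Perm (Fin n)),
        (Finset.univ.filter (fun x => ((p⁻¹ x : Fin n) : ℕ) < s)).card = s := by
      intro s hs p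
      have : Finset.univ.filter (fun x => ((p⁻¹ x : Fin n) : ℕ) < s) =
          (Finset.univ.filter (fun i : Fin n => (i:ℕ) < s)).image p := by
        ext x
        simp only [Finset.mem_filter, Finset.mem_univ, true_and, Finset.mem_image]
        constructor
        · intro hx; exact ⟨_, hx, perm_ai _ _⟩
        · rintro ⟨i, hi, rfl⟩; rwa [perm_ia]
      rw [this, Finset.card_image_of_injective _ p.injective, Fin.card_filter_val_lt]
      omega
    rw [← key t htn v, ← key t' htn' v']
    simp only [hset]
  subst htt
  have hvh : ∀ i : Fin n, (i:ℕ) < t → v i = v' i := fun i hi =>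
    mono_eq (fun i : Fin n => (i:ℕ) < t) (fun i j hij _ hj => hv i j hij hj)
      (fun i j hij _ hj => hv' i j hij hj) hset i hi
  have hyy : y = y' := by
    refine mono_eq' (fun i : Fin m => t ≤ (i:ℕ)) (fun i j hij hi _ => hy i j hij hi)
      (fun i j hij hi _ => hy' i j hij hi) (fun i hi => ?_)
    have hi : (i:ℕ) < t := by omega
    have h1 := h.a ⟨i, by omega⟩ hi
    rw [hvh _ hi, h'.a ⟨i, by omega⟩ hi] at h1
    simpa using h1.symm
  subst hyy
  have hzz : z = z' := by
    refine mono_eq' (fun i : Fin m => (i:ℕ) < t) (fun i j hij _ hj => hz i j hij hj)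
      (fun i j hij _ hj => hz' i j hij hj) (fun i hi => ?_)
    have h1 := h.d i (by omega)
    rw [← h'.d i (by omega)] at h1
    simpa using h1
  subst hzz
  have huu : u = u' := by
    refine mono_eq' (fun i : Fin n => t ≤ (i:ℕ)) (fun i j hij hi _ => hu i j hij hi)
      (fun i j hij hi _ => hu' i j hij hi) (fun i hi => ?_)
    have hi : (i:ℕ) < t := by omega
    have h1 := h.c ⟨i, by omega⟩ hi
    rw [h'.c ⟨i, by omega⟩ hi] at h1
    simpa using h1.symm
  subst huu
  refine ⟨rfl, rfl, ?_, rfl, rfl⟩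
  ext i
  by_cases hi : (i:ℕ) < t
  · rw [hvh i hi]
  · have h1 := h.b i (by omega)
    rw [← h'.b i (by omega)] at h1
    have : v i = v' i := by simpa using h1
    rw [this]

lemma pset_eq {m n t : ℕ} (hm : 0 < m) (htm : t ≤ m) (htn : t ≤ n)
    (y : Equiv.Perm (Fin m)) (v : Equiv.Perm (Fin n))
    (z : Equiv.Perm (Fin m)) (u : Equiv.Perm (Fin n))
    (hy : tailMono t y) (hv : headMono t v) (hz : headMono t z) (hu : tailMono t u)
    (w : Equiv.Perm (Fin (m+n))) (hw : permMat (m+n) w = wBlock m n t y v z u) :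
    Pset m n w = Pt m n t htm htn y v z u := by
  apply Set.Subset.antisymm
  · intro x hx
    obtain ⟨t', htm', htn', y', v', z', u', hy', hv', hz', hu', hx'⟩ := exists_decomp hm x
    obtain ⟨w', hw'⟩ := exists_w htm' htn' y' v' z' u'
    have h1 := forward htm' htn' hy' hv' hz' hu' hx'
    rw [← hw'] at h1
    have hww := bruhat_unique hx h1
    subst hww
    obtain ⟨rfl, rfl, rfl, rfl, rfl⟩ := wd_inj (wdesc htm htn hw) (wdesc htm' htn' hw')
      hy hv hz hu hy' hv' hz' hu'
    exact hx'
  · intro x hx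
    have := forward htm htn hy hv hz hu hx
    rwa [← hw] at this


lemma fe_inl_val {m n : ℕ} (i : Fin n) : ((fe m n (Sum.inl i) : Fin (m+n)) : ℕ) = i := by simp [fe]
lemma fe_inr_val {m n : ℕ} (i : Fin m) : ((fe m n (Sum.inr i) : Fin (m+n)) : ℕ) = n + i := by simp [fe, Nat.add_comm]
lemma wnm_inl {m n : ℕ} (i : Fin n) : wnmPerm m n (fe m n (Sum.inl i)) = fe m n (Sum.inl i.rev) := by
  simp [wnmPerm, revP]
lemma wnm_inr {m n : ℕ} (i : Fin m) : wnmPerm m n (fe m n (Sum.inr i)) = fe m n (Sum.inr i.rev) := by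
  simp [wnmPerm, revP]

section cnt
variable {k : ℕ} (w w' : Equiv.Perm (Fin k)) (p q : Fin k)

lemma cnt1 (h : (Finset.univ.filter (fun j => j ≤ p ∧ w' j < q)).card ≤
      (Finset.univ.filter (fun j => j ≤ p ∧ w j < q)).card) :
    (Finset.univ.filter (fun j => j ≤ p ∧ q ≤ w j)).card ≤
      (Finset.univ.filter (fun j => j ≤ p ∧ q ≤ w' j)).card := by
  have key : ∀ w : Equiv.Perm (Fin k), (Finset.univ.filter (fun j => j ≤ p ∧ w j < q)).card +
    (Finset.univ.filter (fun j => j ≤ p ∧ q ≤ w j)).card = (Finset.univ.filter (fun j => j ≤ p)).card := by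
    intro w
    rw [← Finset.card_filter_add_card_filter_not (s := Finset.univ.filter (fun j => j ≤ p)) (fun j => w j < q),
      Finset.filter_filter, Finset.filter_filter]
    simp only [not_lt]
  have := key w; have := key w'; omega

lemma cnt2 (h : (Finset.univ.filter (fun j => p < j ∧ q ≤ w' j)).card ≤
      (Finset.univ.filter (fun j => p < j ∧ q ≤ w j)).card) :
    (Finset.univ.filter (fun j => j ≤ p ∧ q ≤ w j)).card ≤
      (Finset.univ.filter (fun j => j ≤ p ∧ q ≤ w' j)).card := by
  have key : ∀ w : Equiv.Perm (Fin k), (Finset.univ.filter (fun j => p < j ∧ q ≤ w j)).card +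
    (Finset.univ.filter (fun j => j ≤ p ∧ q ≤ w j)).card = (Finset.univ.filter (fun j => q ≤ j)).card := by
    intro w
    rw [← card_lt_perm w (fun j => q ≤ j),
      ← Finset.card_filter_add_card_filter_not (s := Finset.univ.filter (fun j => q ≤ w j)) (fun j => p < j),
      Finset.filter_filter, Finset.filter_filter]
    simp only [not_lt, and_comm]
  have := key w; have := key w'; omega

lemma cnt3 (h : (Finset.univ.filter (fun j => p < j ∧ w j < q)).card ≤
      (Finset.univ.filter (fun j => p < j ∧ w' j < q)).card) :
    (Finset.univ.filter (fun j => j ≤ p ∧ q ≤ w j)).card ≤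
      (Finset.univ.filter (fun j => j ≤ p ∧ q ≤ w' j)).card := by
  apply cnt1
  have key : ∀ w : Equiv.Perm (Fin k), (Finset.univ.filter (fun j => p < j ∧ w j < q)).card +
    (Finset.univ.filter (fun j => j ≤ p ∧ w j < q)).card = (Finset.univ.filter (fun j => j < q)).card := by
    intro w
    rw [← card_lt_perm w (fun j => j < q),
      ← Finset.card_filter_add_card_filter_not (s := Finset.univ.filter (fun j => w j < q)) (fun j => p < j),
      Finset.filter_filter, Finset.filter_filter]
    simp only [not_lt, and_comm]
  have := key w; have := key w'; omega
end cnt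

lemma bruhat_part {m n t : ℕ} {htm : t ≤ m} {htn : t ≤ n}
    {y : Equiv.Perm (Fin m)} {v : Equiv.Perm (Fin n)}
    {z : Equiv.Perm (Fin m)} {u : Equiv.Perm (Fin n)} {w : Equiv.Perm (Fin (m+n))}
    (h : WD t htm htn y v z u w) (hy : tailMono t y) (hu : tailMono t u)
    (hzy : bruhatLE z y) (hvu : bruhatLE v u) : bruhatLE (wnmPerm m n) w := by
  classical
  rw [bruhat_iff]
  intro p q
  by_cases hp : (p:ℕ) < n <;> by_cases hq : (q:ℕ) < n
  · apply cnt1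
    have h1 : (Finset.univ.filter (fun j => j ≤ p ∧ w j < q)).card ≤ (p+1) - (n-q) := by
      refine le_trans ?_ (comb_count hvu hu (p+1) (n-q))
      rw [← Finset.card_image_of_injective _
        ((fe m n).injective.comp (Sum.inl_injective.comp v.injective))]
      apply Finset.card_le_card
      intro j hj
      simp only [Finset.mem_filter, Finset.mem_univ, true_and, Fin.le_def, Fin.lt_def] at hj
      obtain ⟨j, rfl⟩ := (fe m n).surjective j
      rcases j with j | j
      · obtain ⟨i, rfl⟩ := v.surjective j
        rw [Finset.mem_image]
        refine ⟨i, ?_, rfl⟩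
        by_cases hi : (i:ℕ) < t
        · rw [h.a i hi, fe_inr_val] at hj; omega
        · rw [h.b i (by omega), fe_inl_val, fe_inl_val] at hj
          have : ((revP n (u i) : Fin n) : ℕ) = n - (u i + 1) := Fin.val_rev _
          simp only [Finset.mem_filter, Finset.mem_univ, true_and]
          omega
      · rw [fe_inr_val] at hj; omega
    refine h1.trans ?_
    rw [← Finset.card_fin (p + 1 - (n-q))]
    refine Finset.card_le_card_of_injOn (fun a => fe m n (Sum.inl ⟨n - q + a, by omega⟩)) ?_ ?_
    · intro a _
      simp only [Finset.coe_filter, Finset.mem_univ, true_and, Set.mem_ofPred_eq, Fin.le_def, Fin.lt_def]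
      rw [wnm_inl, fe_inl_val, fe_inl_val, Fin.val_rev]
      dsimp only
      omega
    · intro a _ b _ hab
      simpa [Fin.ext_iff] using hab
  · rw [Finset.card_eq_zero.2]
    · exact Nat.zero_le _
    · rw [Finset.filter_eq_empty_iff]
      intro j _
      obtain ⟨j, rfl⟩ := (fe m n).surjective j
      rw [Fin.le_def, Fin.le_def]
      rcases j with j | j
      · rw [wnm_inl, fe_inl_val, fe_inl_val]; omega
      · rw [fe_inr_val]; omega
  · apply cnt3
    rw [Finset.card_eq_zero.2]
    · exact Nat.zero_le _
    · rw [Finset.filter_eq_empty_iff]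
      intro j _
      obtain ⟨j, rfl⟩ := (fe m n).surjective j
      rw [Fin.lt_def, Fin.lt_def]
      rcases j with j | j
      · rw [fe_inl_val]; omega
      · rw [wnm_inr, fe_inr_val, fe_inr_val]; omega
  · apply cnt2
    have h1 : (Finset.univ.filter (fun j => p < j ∧ q ≤ w j)).card ≤ (m+n-1-p) - (q-n) := by
      refine le_trans ?_ (comb_count hzy hy (m+n-1-p) (q-n))
      rw [← Finset.card_image_of_injective _
        ((fe m n).injective.comp (Sum.inr_injective.comp ((revP m).injective.comp z.injective)))]
      apply Finset.card_le_card
      intro j hj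
      simp only [Finset.mem_filter, Finset.mem_univ, true_and, Fin.le_def, Fin.lt_def] at hj
      obtain ⟨j, rfl⟩ := (fe m n).surjective j
      rcases j with j | j
      · rw [fe_inl_val] at hj; omega
      · obtain ⟨i, rfl⟩ := ((revP m).surjective.comp z.surjective) j
        rw [Finset.mem_image]
        refine ⟨i, ?_, rfl⟩
        simp only [Function.comp_apply] at hj
        by_cases hi : (i:ℕ) < t
        · rw [h.c i hi, fe_inl_val] at hj; omega
        · rw [h.d i (by omega), fe_inr_val, fe_inr_val] at hj
          have : ((revP m (z i) : Fin m) : ℕ) = m - (z i + 1) := Fin.val_rev _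
          simp only [Finset.mem_filter, Finset.mem_univ, true_and]
          omega
    refine h1.trans ?_
    rw [← Finset.card_fin (m+n-1-p - (q-n))]
    refine Finset.card_le_card_of_injOn (fun a => fe m n (Sum.inr ⟨p - n + 1 + a, by omega⟩)) ?_ ?_
    · intro a _
      simp only [Finset.coe_filter, Finset.mem_univ, true_and, Set.mem_ofPred_eq, Fin.le_def, Fin.lt_def]
      rw [wnm_inr, fe_inr_val, fe_inr_val, Fin.val_rev]
      dsimp only
      omega
    · intro a _ b _ hab
      simpa [Fin.ext_iff] using hab

theorem statement13 (m n t : ℕ) (hm : 0 < m) (hn : 0 < n) (htm : t ≤ m) (htn : t ≤ n)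
    (y : Equiv.Perm (Fin m)) (v : Equiv.Perm (Fin n))
    (z : Equiv.Perm (Fin m)) (u : Equiv.Perm (Fin n))
    (hy : tailMono t y) (hv : headMono t v) (hz : headMono t z) (hu : tailMono t u)
    (hzy : bruhatLE z y) (hvu : bruhatLE v u)
    (w : Equiv.Perm (Fin (m+n))) (hw : permMat (m+n) w = wBlock m n t y v z u) :
    bruhatLE (wnmPerm m n) w ∧ Pset m n w = Pt m n t htm htn y v z u := by
  exact ⟨bruhat_part (wdesc htm htn hw) hy hu hzy hvu, pset_eq hm htm htn y v z u hy hv hz hu w hw⟩
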